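/- arXiv:1111.1182 — 8 statements merged into one kernel-verified Lean document; each statement's English description precedes it below -/
import Mathlib

section
/- Let u be a smooth periodic solution of the viscous Burgers equation on Q with viscosity ν ≥ 0 and initial data u₀. Then sup_{(x,t) ∈ [0,1] × [0,T]} ∂_x u(x,t) ≤ sup_{x ∈ [0,1]} u₀'(x), i.e. the maximum of the space derivative never exceeds that of the initial data. -/
open Set

lemma burgers_mixed (T t x : ℝ) (ht : t ∈ Ioc (0:ℝ) T)
    (u ux g v uxt : ℝ → ℝ → ℝ)
    (hv_cont : Continuous fun p : ℝ × ℝ => v p.1 p.2)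
    (huxt_cont : Continuous fun p : ℝ × ℝ => uxt p.1 p.2)
    (hux : ∀ x t, HasDerivAt (fun y => u y t) (ux x t) x)
    (hg : ∀ x t, HasDerivAt (fun y => g y t) (v x t) x)
    (hut : ∀ x, ∀ t ∈ Ioc (0 : ℝ) T,
      HasDerivWithinAt (fun s => u x s) (g x t) (Icc (0 : ℝ) T) t)
    (huxt : ∀ x, ∀ t ∈ Icc (0 : ℝ) T,
      HasDerivWithinAt (fun s => ux x s) (uxt x t) (Icc (0 : ℝ) T) t) :
    v x t = uxt x t := by
  have key : ∀ h, 0 < h → h < t → ∃ a ∈ Ioo x (x+h), ∃ b ∈ Ioo (t-h) t,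
      ∃ c ∈ Ioo x (x+h), ∃ d ∈ Ioo (t-h) t, v a b = uxt c d := by
    intro h h0 h1
    have hsub : Icc (t-h) t ⊆ Ioc 0 T := fun s hs => ⟨by linarith [hs.1], hs.2.trans ht.2⟩
    have hnhds : ∀ s ∈ Ioo (t-h) t, Icc (0:ℝ) T ∈ nhds s := fun s hs =>
      Icc_mem_nhds (by linarith [hs.1]) (by linarith [hs.2, ht.2])
    -- first: in time
    obtain ⟨b, hb, hb'⟩ := exists_hasDerivAt_eq_slope
      (fun s => u (x+h) s - u x s) (fun s => g (x+h) s - g x s) (show t - h < t by linarith)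
      (fun s hs => (((hut (x+h) s (hsub hs)).sub (hut x s (hsub hs))).continuousWithinAt).mono
        (hsub.trans Ioc_subset_Icc_self))
      (fun s hs => ((hut (x+h) s (hsub (Ioo_subset_Icc_self hs))).sub
        (hut x s (hsub (Ioo_subset_Icc_self hs)))).hasDerivAt (hnhds s hs))
    obtain ⟨a, ha, ha'⟩ := exists_hasDerivAt_eq_slope
      (fun y => g y b) (fun y => v y b) (show x < x + h by linarith)
      (fun y _ => (hg y b).continuousAt.continuousWithinAt) (fun y _ => hg y b)
    obtain ⟨c, hc, hc'⟩ := exists_hasDerivAt_eq_slope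
      (fun y => u y t - u y (t-h)) (fun y => ux y t - ux y (t-h)) (show x < x + h by linarith)
      (fun y _ => ((hux y t).sub (hux y (t-h))).continuousAt.continuousWithinAt)
      (fun y _ => (hux y t).sub (hux y (t-h)))
    obtain ⟨d, hd, hd'⟩ := exists_hasDerivAt_eq_slope
      (fun s => ux c s) (fun s => uxt c s) (show t - h < t by linarith)
      (fun s hs => ((huxt c s (Ioc_subset_Icc_self (hsub hs))).continuousWithinAt).mono
        (hsub.trans Ioc_subset_Icc_self))
      (fun s hs => (huxt c s (Ioc_subset_Icc_self (hsub (Ioo_subset_Icc_self hs)))).hasDerivAt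
        (hnhds s hs))
    refine ⟨a, ha, b, hb, c, hc, d, hd, ?_⟩
    rw [ha', hd', hb', hc']
    congr 1
    · ring
    · ring
  by_contra hne
  have hF : Continuous fun q : (ℝ × ℝ) × (ℝ × ℝ) => v q.1.1 q.1.2 - uxt q.2.1 q.2.2 :=
    (hv_cont.comp continuous_fst).sub (huxt_cont.comp continuous_snd)
  have hev : ∀ᶠ q in nhds (((x,t),(x,t)) : (ℝ × ℝ) × (ℝ × ℝ)),
      v q.1.1 q.1.2 - uxt q.2.1 q.2.2 ≠ 0 :=
    hF.continuousAt.eventually_ne (sub_ne_zero.2 hne)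
  obtain ⟨ε, hε, hball⟩ := Metric.eventually_nhds_iff.1 hev
  have ht0 := ht.1
  have hm : 0 < min ε t / 2 := by positivity
  have hm1 : min ε t ≤ ε := min_le_left _ _
  have hm2 : min ε t ≤ t := min_le_right _ _
  obtain ⟨a, ha, b, hb, c, hc, d, hd, he⟩ := key (min ε t / 2) hm (by linarith)
  refine hball (y := ((a,b),(c,d))) ?_ (sub_eq_zero.2 he)
  simp only [Prod.dist_eq, Real.dist_eq, max_lt_iff, abs_lt]
  obtain ⟨ha1, ha2⟩ := ha
  obtain ⟨hb1, hb2⟩ := hb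
  obtain ⟨hc1, hc2⟩ := hc
  obtain ⟨hd1, hd2⟩ := hd
  refine ⟨⟨⟨?_, ?_⟩, ?_, ?_⟩, ⟨?_, ?_⟩, ?_, ?_⟩ <;> linarith

lemma second_deriv_nonpos_of_max (f f' : ℝ → ℝ) (f'' x : ℝ)
    (hf : ∀ y, HasDerivAt f (f' y) y) (hf' : HasDerivAt f' f'' x)
    (hmax : ∀ y, f y ≤ f x) : f' x = 0 ∧ f'' ≤ 0 := by
  have hM : IsLocalMax f x := Filter.Eventually.of_forall hmax
  have h0 : f' x = 0 := hM.hasDerivAt_eq_zero (hf x)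
  refine ⟨h0, ?_⟩
  by_contra! hpos
  have hd : deriv f = f' := funext fun y => (hf y).deriv
  have hmin : IsLocalMin f x := isLocalMin_of_deriv_deriv_pos
    (by rw [hd, hf'.deriv]; exact hpos) (by rw [hd, h0]) (hf x).continuousAt
  have hc : f =ᶠ[nhds x] fun _ => f x := by
    filter_upwards [hmin] with y hy using le_antisymm (hmax y) hy
  have h1 := hc.deriv.deriv_eq
  rw [hd, hf'.deriv] at h1
  simp at h1
  linarith

/-- **Maximum principle for the space derivative of the Burgers solution.**
If `u` is a smooth 1-periodic (in space) solution of
`∂ₜ u + u ∂ₓ u − ν ∂ₓₓ u = 0` on `ℝ × (0,T]` with viscosity `ν ≥ 0` and initial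
data `u₀` (with `∂ₓ u` being `C²` in `x` and `C¹` in `t`), then
`sup_{[0,1]×[0,T]} ∂ₓ u ≤ sup_{[0,1]} u₀'`. -/
theorem burgers_gradient_maximum_principle
    (T ν : ℝ) (hT : 0 < T) (hν : 0 ≤ ν)
    (u ux uxx uxxx ut uxt : ℝ → ℝ → ℝ) (u₀ : ℝ → ℝ)
    (hper : ∀ x t, u (x + 1) t = u x t)
    (hu_cont : Continuous fun p : ℝ × ℝ => u p.1 p.2)
    (hux_cont : Continuous fun p : ℝ × ℝ => ux p.1 p.2)
    (huxx_cont : Continuous fun p : ℝ × ℝ => uxx p.1 p.2)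
    (huxxx_cont : Continuous fun p : ℝ × ℝ => uxxx p.1 p.2)
    (hut_cont : Continuous fun p : ℝ × ℝ => ut p.1 p.2)
    (huxt_cont : Continuous fun p : ℝ × ℝ => uxt p.1 p.2)
    (hux : ∀ x t, HasDerivAt (fun y => u y t) (ux x t) x)
    (huxx : ∀ x t, HasDerivAt (fun y => ux y t) (uxx x t) x)
    (huxxx : ∀ x t, HasDerivAt (fun y => uxx y t) (uxxx x t) x)
    (hut : ∀ x, ∀ t ∈ Icc (0 : ℝ) T,
      HasDerivWithinAt (fun s => u x s) (ut x t) (Icc (0 : ℝ) T) t)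
    (huxt : ∀ x, ∀ t ∈ Icc (0 : ℝ) T,
      HasDerivWithinAt (fun s => ux x s) (uxt x t) (Icc (0 : ℝ) T) t)
    (hpde : ∀ x, ∀ t ∈ Ioc (0 : ℝ) T,
      ut x t + u x t * ux x t - ν * uxx x t = 0)
    (hinit : ∀ x, u x 0 = u₀ x) :
    ∀ x ∈ Icc (0 : ℝ) 1, ∀ t ∈ Icc (0 : ℝ) T,
      ux x t ≤ sSup (deriv u₀ '' Icc (0 : ℝ) 1) := by
  have huxper : ∀ t, Function.Periodic (fun x => ux x t) 1 := by
    intro t x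
    have h1 : HasDerivAt (fun y => u (y + 1) t) (ux (x+1) t) x :=
      (hux (x+1) t).comp_add_const x 1
    simp only [hper] at h1
    exact h1.unique (hux x t)
  have hd0 : deriv u₀ = fun x => ux x 0 := by
    funext x
    have : u₀ = fun y => u y 0 := funext fun y => (hinit y).symm
    rw [this]
    exact (hux x 0).deriv
  have hbdd : BddAbove (deriv u₀ '' Icc (0:ℝ) 1) := by
    rw [hd0]
    exact isCompact_Icc.bddAbove_image
      (hux_cont.comp (continuous_id.prodMk continuous_const)).continuousOn
  have hmixed : ∀ x, ∀ t ∈ Ioc (0:ℝ) T,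
      ν * uxxx x t - (ux x t * ux x t + u x t * uxx x t) = uxt x t := by
    intro x t ht
    refine burgers_mixed T t x ht u ux (fun x t => ν * uxx x t - u x t * ux x t)
      (fun x t => ν * uxxx x t - (ux x t * ux x t + u x t * uxx x t)) uxt ?_ huxt_cont hux ?_ ?_ huxt
    · fun_prop
    · intro x t
      exact ((huxxx x t).const_mul ν).sub ((hux x t).mul (huxx x t))
    · intro x t ht
      have h := hut x t (Ioc_subset_Icc_self ht)
      have h2 : ut x t = ν * uxx x t - u x t * ux x t := by linarith [hpde x t ht]
      rwa [h2] at h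
  intro x hx t ht
  have main : ∀ ε > 0, ux x t ≤ sSup (deriv u₀ '' Icc (0 : ℝ) 1) + ε * t := by
    intro ε hε
    have hcont : Continuous fun p : ℝ × ℝ => ux p.1 p.2 - ε * p.2 := by fun_prop
    obtain ⟨⟨a, s⟩, ⟨ha, hs⟩, hmax⟩ := (isCompact_Icc.prod isCompact_Icc :
      IsCompact (Icc (0:ℝ) 1 ×ˢ Icc (0:ℝ) T)).exists_isMaxOn ⟨(x,t), hx, ht⟩ hcont.continuousOn
    simp only at ha hs
    have hmax' : ∀ y ∈ Icc (0:ℝ) 1, ∀ r ∈ Icc (0:ℝ) T,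
        ux y r - ε * r ≤ ux a s - ε * s := fun y hy r hr => hmax (show (y, r) ∈ _ from ⟨hy, hr⟩)
    have hs0 : s = 0 := by
      by_contra hne
      have hspos : 0 < s := lt_of_le_of_ne hs.1 (Ne.symm hne)
      have hglob : ∀ y, ux y s ≤ ux a s := by
        intro y
        obtain ⟨z, hz, hyz⟩ := (huxper s).exists_mem_Ico₀ one_pos y
        rw [hyz]
        linarith [hmax' z (Ico_subset_Icc_self hz) s hs]
      obtain ⟨h1, h2⟩ := second_deriv_nonpos_of_max (fun y => ux y s) (fun y => uxx y s)
        (uxxx a s) a (fun y => huxx y s) (huxxx a s) hglob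
      have h3 : HasDerivWithinAt (fun r => ux a r - ε * r) (uxt a s - ε * 1) (Icc (0:ℝ) T) s :=
        (huxt a s hs).sub ((hasDerivWithinAt_id s _).const_mul ε)
      have h4 : IsLocalMaxOn (fun r => ux a r - ε * r) (Icc (0:ℝ) T) s := by
        refine IsMaxOn.localize ?_
        intro r hr
        exact hmax' a ha r hr
      have h5 := h4.hasFDerivWithinAt_nonpos h3.hasFDerivWithinAt (y := 0 - s)
        (sub_mem_posTangentConeAt_of_segment_subset
          ((convex_Icc (0:ℝ) T).segment_subset hs ⟨le_rfl, hT.le⟩))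
      simp at h5
      have h6 := hmixed a s ⟨hspos, hs.2⟩
      rw [h1] at h6
      have h7 : ν * uxxx a s ≤ 0 := mul_nonpos_of_nonneg_of_nonpos hν h2
      have h8 : uxt a s - ε < 0 := by nlinarith [mul_self_nonneg (ux a s)]
      nlinarith
    have h1 := hmax' x hx t ht
    have h2 : ux a 0 ≤ sSup (deriv u₀ '' Icc (0 : ℝ) 1) :=
      le_csSup hbdd ⟨a, ha, by rw [hd0]⟩
    rw [hs0] at h1
    linarith
  refine le_of_forall_pos_le_add fun δ hδ => ?_
  have h := main (δ / T) (by positivity)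
  have h2 : δ / T * t ≤ δ := by
    rw [div_mul_eq_mul_div, div_le_iff₀ hT]
    exact mul_le_mul_of_nonneg_left ht.2 hδ.le
  linarith
end

section
/- Let δ > 0, let u : ℝ → ℝ be 1-periodic and four times continuously differentiable, and let ũ be the differential filter of u, i.e. the 1-periodic C⁴ solution of −δ² ũ'' + ũ = u. Then ‖u − ũ‖_{L²(0,1)} ≤ δ² ‖u''‖_{L²(0,1)}, so the filtering error is of order δ² for smooth functions. -/
open Set intervalIntegral

/-- **Filtering error of the differential filter.**
Let `δ > 0`, let `u` be 1-periodic and `C⁴`, and let `utilde` be the 1-periodic `C⁴`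
solution of `−δ² utilde'' + utilde = u`.  Then `‖u − utilde‖_{L²(0,1)} ≤ δ² ‖u''‖_{L²(0,1)}`. -/
theorem differential_filter_error
    (δ : ℝ) (hδ : 0 < δ)
    (u utilde : ℝ → ℝ)
    (hu_smooth : ContDiff ℝ 4 u)
    (hu_per : ∀ x, u (x + 1) = u x)
    (hutilde_smooth : ContDiff ℝ 4 utilde)
    (hutilde_per : ∀ x, utilde (x + 1) = utilde x)
    (hfilter : ∀ x, -δ ^ 2 * iteratedDeriv 2 utilde x + utilde x = u x) :
    Real.sqrt (∫ x in (0 : ℝ)..1, (u x - utilde x) ^ 2)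
      ≤ δ ^ 2 * Real.sqrt (∫ x in (0 : ℝ)..1, (iteratedDeriv 2 u x) ^ 2) := by
  have h2 : ∀ f : ℝ → ℝ, iteratedDeriv 2 f = deriv (deriv f) := fun f => by
    rw [iteratedDeriv_succ, iteratedDeriv_one]
  have hper : ∀ f : ℝ → ℝ, (∀ x, f (x + 1) = f x) → ∀ x, deriv f (x + 1) = deriv f x := by
    intro f hf x
    rw [← deriv_comp_add_const]
    congr 1
    funext y
    exact hf y
  have c1 : ContDiff ℝ 3 (deriv utilde) :=
    ((contDiff_succ_iff_deriv (n := 3)).1 (hutilde_smooth.of_le (by norm_num))).2.2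
  have c2 : ContDiff ℝ 2 (deriv (deriv utilde)) :=
    ((contDiff_succ_iff_deriv (n := 2)).1 (c1.of_le (by norm_num))).2.2
  rw [h2] at *
  have pw := hper _ (hper _ hutilde_per)
  have du : Differentiable ℝ utilde := hutilde_smooth.differentiable (by norm_num)
  have du' : Differentiable ℝ (deriv utilde) := c1.differentiable (by norm_num)
  have hu : u = fun x => utilde x - δ ^ 2 * deriv (deriv utilde) x := by
    funext x
    rw [← hfilter x]
    ring
  generalize hw : deriv (deriv utilde) = w at *
  have c3 : ContDiff ℝ 1 (deriv w) :=
    ((contDiff_succ_iff_deriv (n := 1)).1 (c2.of_le (by norm_num))).2.2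
  have c4 : Continuous (deriv (deriv w)) := c3.continuous_deriv (by norm_num)
  have dw : Differentiable ℝ w := c2.differentiable (by norm_num)
  have dw' : Differentiable ℝ (deriv w) := c3.differentiable (by norm_num)
  have hu1 : deriv u = fun x => deriv utilde x - δ ^ 2 * deriv w x := by
    funext x
    rw [hu]
    exact ((du x).hasDerivAt.sub ((dw x).hasDerivAt.const_mul _)).deriv
  have hu2 : deriv (deriv u) = fun x => w x - δ ^ 2 * deriv (deriv w) x := by
    funext x
    rw [hu1, ← hw]
    rw [← hw] at dw'
    exact ((du' x).hasDerivAt.sub ((dw' x).hasDerivAt.const_mul _)).deriv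
  have cw := c2.continuous
  have cw' := c3.continuous
  have hG : ∫ x in (0 : ℝ)..1, (deriv w x * deriv w x + w x * deriv (deriv w) x) = 0 := by
    rw [integral_eq_sub_of_hasDerivAt (f := fun x => w x * deriv w x)
      (fun x _ => (dw x).hasDerivAt.mul (dw' x).hasDerivAt)
      ((by fun_prop : Continuous _).intervalIntegrable _ _)]
    have e1 := pw 0
    have e2 := hper _ pw 0
    rw [zero_add] at e1 e2
    rw [e1, e2, sub_self]
  have key : ∫ x in (0 : ℝ)..1, (w x) ^ 2 ≤ ∫ x in (0 : ℝ)..1, (deriv (deriv u) x) ^ 2 := by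
    have e : ∫ x in (0 : ℝ)..1, (w x) ^ 2 = ∫ x in (0 : ℝ)..1,
        ((w x) ^ 2 - 2 * δ ^ 2 * (deriv w x * deriv w x + w x * deriv (deriv w) x)) := by
      rw [integral_sub ((by fun_prop : Continuous _).intervalIntegrable _ _)
        ((by fun_prop : Continuous _).intervalIntegrable _ _), integral_const_mul, hG]
      ring
    rw [e, hu2]
    apply integral_mono_on zero_le_one ((by fun_prop : Continuous _).intervalIntegrable _ _)
      ((by fun_prop : Continuous _).intervalIntegrable _ _)
    intro x _
    nlinarith [sq_nonneg (δ ^ 2 * deriv (deriv w) x), sq_nonneg (δ * deriv w x)]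
  have e : ∫ x in (0 : ℝ)..1, (u x - utilde x) ^ 2
      = (δ ^ 2) ^ 2 * ∫ x in (0 : ℝ)..1, (w x) ^ 2 := by
    rw [← integral_const_mul]
    congr 1
    funext x
    rw [hu]
    ring
  rw [e, Real.sqrt_mul (by positivity), Real.sqrt_sq (by positivity)]
  gcongr
end

section
/- Let u : [0,T] → (ℤ/Nℤ → ℝ) solve the mass-lumped Galerkin scheme with linear artificial viscosity. Then the discrete maximum principle holds: for all t ∈ [0,T] and all i ∈ ℤ/Nℤ, |u_i(t)| ≤ U₀ := max_{j} |u_j(0)|. -/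
open Set

lemma alg_bound (a b c k U e : ℝ) (hU : 0 ≤ U) (he : 0 ≤ e) (hk : U / 2 ≤ k)
    (hb : b = U + e) (ha : |a| ≤ U + e) (hc : |c| ≤ U + e) :
    -(1 / 6) * (a ^ 2 + b * a - b * c - c ^ 2) + k * (a - 2 * b + c) ≤ 3 / 2 * e ^ 2 := by
  obtain ⟨ha1, ha2⟩ := abs_le.1 ha
  obtain ⟨hc1, hc2⟩ := abs_le.1 hc
  have key : -(1 / 6) * (a ^ 2 + b * a - b * c - c ^ 2) + k * (a - 2 * b + c)
      = -((b - a) * (k - (a + 2 * b) / 6)) - (b - c) * (k + (c + 2 * b) / 6) := by ring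
  have h2 : 0 ≤ (b - c) * (k + (c + 2 * b) / 6) :=
    mul_nonneg (by linarith) (by linarith)
  have h1 : -(3 / 2 * e ^ 2) ≤ (b - a) * (k - (a + 2 * b) / 6) := by
    have h3 : (b - a) * (U / 2 - (a + 2 * b) / 6) ≤ (b - a) * (k - (a + 2 * b) / 6) :=
      mul_le_mul_of_nonneg_left (by linarith) (by linarith)
    have h4 : (b - a) * (U / 2 - (a + 2 * b) / 6)
        = (b - a) * ((b - a) - 3 * e) / 6 := by rw [hb]; ring
    nlinarith [sq_nonneg (b - a - 3 / 2 * e), sq_nonneg e]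
  linarith

lemma right_ev (w : ℝ → ℝ) (w' t T : ℝ) (ht : t ∈ Ico (0 : ℝ) T)
    (hw : HasDerivWithinAt w w' (Icc (0 : ℝ) T) t) (h0 : 0 ≤ w t) (hp : w t = 0 → 0 < w') :
    ∀ᶠ s in nhdsWithin t (Ioi t), 0 ≤ w s := by
  have hle : nhdsWithin t (Ioi t) ≤ nhdsWithin t (Icc 0 T) := by
    rw [← nhdsWithin_Ioc_eq_nhdsGT ht.2]
    exact nhdsWithin_mono _ fun s hs => ⟨ht.1.trans hs.1.le, hs.2⟩
  rcases h0.eq_or_lt with h | h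
  · have hw2 : HasDerivWithinAt w w' (Ioi t) t := by
      have : HasDerivWithinAt w w' (Ioc t T) t :=
        hw.mono fun s hs => ⟨ht.1.trans hs.1.le, hs.2⟩
      exact this.mono_of_mem_nhdsWithin (Ioc_mem_nhdsGT ht.2)
    rw [hasDerivWithinAt_iff_tendsto_slope' self_notMem_Ioi] at hw2
    filter_upwards [hw2.eventually (lt_mem_nhds (hp h.symm)), self_mem_nhdsWithin] with s hs hst
    have hst' : 0 < s - t := sub_pos.2 hst
    rw [slope_def_field, ← h, sub_zero] at hs
    exact ((div_pos_iff_of_pos_right hst').1 hs).le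
  · exact ((hw.continuousWithinAt.mono_left hle).eventually (lt_mem_nhds h)).mono
      fun s hs => le_of_lt hs

/-- **Discrete maximum principle for the mass-lumped Galerkin scheme with linear
artificial viscosity.**  On the uniform periodic mesh with `N ≥ 3` nodes,
`h = 1/N`, if the nodal values `u i` satisfy
`h uᵢ' = −(1/6)(uᵢ₊₁² + uᵢuᵢ₊₁ − uᵢuᵢ₋₁ − uᵢ₋₁²) + ν̂ dᵢ − ν̂ dᵢ₋₁`
with `ν̂ = max(U₀ h/2, ν)`, then `|uᵢ(t)| ≤ U₀ := maxⱼ |uⱼ(0)|` on `[0,T]`. -/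
theorem discrete_maximum_principle_linear_viscosity
    (N : ℕ) [NeZero N] (hN : 3 ≤ N)
    (T ν : ℝ) (hT : 0 < T) (hν : 0 ≤ ν)
    (u u' : ℝ → ZMod N → ℝ)
    (h : ℝ) (hh : h = 1 / N)
    (d : ℝ → ZMod N → ℝ)
    (hd : ∀ t i, d t i = (u t (i + 1) - u t i) / h)
    (U₀ : ℝ)
    (hU₀ : U₀ = Finset.univ.sup' ⟨(0 : ZMod N), Finset.mem_univ _⟩ fun j => |u 0 j|)
    (νhat : ℝ) (hνhat : νhat = max (U₀ * h / 2) ν)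
    (hderiv : ∀ i, ∀ t ∈ Icc (0 : ℝ) T,
      HasDerivWithinAt (fun s => u s i) (u' t i) (Icc (0 : ℝ) T) t)
    (hscheme : ∀ i, ∀ t ∈ Icc (0 : ℝ) T,
      h * u' t i
        = -(1 / 6) * (u t (i + 1) ^ 2 + u t i * u t (i + 1)
            - u t i * u t (i - 1) - u t (i - 1) ^ 2)
          + νhat * d t i - νhat * d t (i - 1)) :
    ∀ t ∈ Icc (0 : ℝ) T, ∀ i : ZMod N, |u t i| ≤ U₀ := by
  have hNpos : (0 : ℝ) < N := by exact_mod_cast (by omega : 0 < N)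
  have hpos : 0 < h := by rw [hh]; positivity
  have hinit : ∀ i, |u 0 i| ≤ U₀ := fun i => by
    rw [hU₀]; exact Finset.le_sup' (fun j => |u 0 j|) (Finset.mem_univ i)
  have hU : 0 ≤ U₀ := (abs_nonneg _).trans (hinit 0)
  have hk : U₀ / 2 ≤ νhat / h := by
    rw [le_div_iff₀ hpos, hνhat]
    exact le_trans (le_of_eq (by ring)) (le_max_left _ _)
  have hs : ∀ i, ∀ t ∈ Icc (0 : ℝ) T, h * u' t i
      = -(1 / 6) * (u t (i + 1) ^ 2 + u t i * u t (i + 1)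
            - u t i * u t (i - 1) - u t (i - 1) ^ 2)
        + νhat / h * (u t (i + 1) - 2 * u t i + u t (i - 1)) := by
    intro i t ht
    rw [hscheme i t ht, hd, hd, sub_add_cancel]
    ring
  -- the barrier estimate
  have main : ∀ δ : ℝ, 0 < δ → 3 / 2 * δ * (1 + T) ^ 2 < h →
      ∀ t ∈ Icc (0 : ℝ) T, ∀ i, |u t i| ≤ U₀ + δ * (1 + t) := by
    intro δ hδ hδh
    let S : Set ℝ := {t | ∀ i, |u t i| ≤ U₀ + δ * (1 + t)}
    have hcont : ∀ i, ContinuousOn (fun s => u s i) (Icc 0 T) :=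
      fun i t ht => (hderiv i t ht).continuousWithinAt
    have hclosed : IsClosed (S ∩ Icc 0 T) := by
      have : S ∩ Icc 0 T = ⋂ i, {t ∈ Icc (0 : ℝ) T | |u t i| ≤ U₀ + δ * (1 + t)} := by
        ext t
        simp only [S, mem_inter_iff, mem_setOf_eq, mem_iInter]
        exact ⟨fun hx i => ⟨hx.2, hx.1 i⟩, fun hx => ⟨fun i => (hx i).2, (hx 0).1⟩⟩
      rw [this]
      exact isClosed_iInter fun i =>
        isClosed_Icc.isClosed_le (hcont i).abs (by fun_prop)
    have hsub : Icc 0 T ⊆ S := by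
      refine hclosed.Icc_subset_of_forall_mem_nhdsWithin ?_ ?_
      · intro i
        have := hinit i
        linarith
      · rintro t ⟨htS, ht⟩
        have htI : t ∈ Icc 0 T := ⟨ht.1, ht.2.le⟩
        have hquad : 3 / 2 * (δ * (1 + t)) ^ 2 < h * δ := by
          have h1 : (1 + t) ^ 2 ≤ (1 + T) ^ 2 :=
            pow_le_pow_left₀ (by linarith [ht.1]) (by linarith [ht.2]) 2
          have h2 : 3 / 2 * δ * (1 + t) ^ 2 ≤ 3 / 2 * δ * (1 + T) ^ 2 :=
            mul_le_mul_of_nonneg_left h1 (by positivity)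
          calc 3 / 2 * (δ * (1 + t)) ^ 2 = (3 / 2 * δ * (1 + t) ^ 2) * δ := by ring
            _ < h * δ := mul_lt_mul_of_pos_right (h2.trans_lt hδh) hδ
        have he : 0 ≤ δ * (1 + t) := mul_nonneg hδ.le (by linarith [ht.1])
        have hbar : HasDerivWithinAt (fun s : ℝ => U₀ + δ * (1 + s)) δ (Icc 0 T) t := by
          simpa using ((((hasDerivAt_id t).const_add 1).const_mul δ).const_add U₀).hasDerivWithinAt
        have hall : ∀ i, ∀ᶠ s in nhdsWithin t (Ioi t), |u s i| ≤ U₀ + δ * (1 + s) := by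
          intro i
          have hb := abs_le.1 (htS i)
          have hp := right_ev _ _ t T ht (hbar.sub (hderiv i t htI))
            (by simp only [Pi.sub_apply]; linarith) (by
              intro h0
              simp only [Pi.sub_apply] at h0
              have := alg_bound (u t (i + 1)) (u t i) (u t (i - 1)) (νhat / h) U₀ (δ * (1 + t))
                hU he hk (by linarith) (htS _) (htS _)
              rw [← hs i t htI] at this
              have := lt_of_mul_lt_mul_left (this.trans_lt hquad) hpos.le
              linarith)
          have hm := right_ev _ _ t T ht (hbar.add (hderiv i t htI))
            (by simp only [Pi.add_apply]; linarith) (by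
              intro h0
              simp only [Pi.add_apply] at h0
              have := alg_bound (-u t (i - 1)) (-u t i) (-u t (i + 1)) (νhat / h) U₀
                (δ * (1 + t)) hU he hk (by linarith) (by rw [abs_neg]; exact htS _)
                (by rw [abs_neg]; exact htS _)
              have h2 : h * (-u' t i) ≤ 3 / 2 * (δ * (1 + t)) ^ 2 := by
                rw [mul_neg, hs i t htI]
                refine le_trans (le_of_eq ?_) this
                ring
              have := lt_of_mul_lt_mul_left (h2.trans_lt hquad) hpos.le
              linarith)
          filter_upwards [hp, hm] with s h1 h2
          simp only [Pi.sub_apply, Pi.add_apply] at h1 h2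
          exact abs_le.2 ⟨by linarith, by linarith⟩
        exact Filter.eventually_all.2 hall
    exact fun t ht i => hsub ht i
  intro t ht i
  have hT2 : 0 < 3 / 2 * (1 + T) ^ 2 := by positivity
  refine le_of_forall_pos_lt_add fun ε hε => ?_
  have h1t : 0 < 1 + t := by linarith [ht.1]
  let δ := min (h / (3 / 2 * (1 + T) ^ 2)) (ε / (1 + t)) / 2
  have hm : 0 < min (h / (3 / 2 * (1 + T) ^ 2)) (ε / (1 + t)) :=
    lt_min (by positivity) (by positivity)
  have hδ : 0 < δ := half_pos hm
  have hδ1 : δ < h / (3 / 2 * (1 + T) ^ 2) := (half_lt_self hm).trans_le (min_le_left _ _)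
  have hδ2 : δ < ε / (1 + t) := (half_lt_self hm).trans_le (min_le_right _ _)
  rw [lt_div_iff₀ hT2] at hδ1
  rw [lt_div_iff₀ h1t] at hδ2
  have := main δ hδ (by linarith) t ht i
  linarith
end

section
/- Let u : [0,T] → (ℤ/Nℤ → ℝ) solve the mass-lumped Galerkin scheme with nonlinear artificial viscosity and regularization parameter ε = 0. Then the discrete maximum principle holds: for all t ∈ [0,T] and all i ∈ ℤ/Nℤ, |u_i(t)| ≤ max_{j} |u_j(0)|. -/
open Set

/-- If every component attaining the maximum has nonpositive derivative, then any initial upper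
bound persists. -/
lemma dmp_max_nonincreasing {ι : Type*} [Fintype ι] [Nonempty ι] (T : ℝ) (v v' : ℝ → ι → ℝ)
    (hv : ∀ i, ∀ t ∈ Icc (0 : ℝ) T,
      HasDerivWithinAt (fun s => v s i) (v' t i) (Icc (0 : ℝ) T) t)
    (hmax : ∀ i, ∀ t ∈ Icc (0 : ℝ) T, (∀ j, v t j ≤ v t i) → v' t i ≤ 0)
    (C : ℝ) (hC : ∀ j, v 0 j ≤ C) :
    ∀ t ∈ Icc (0 : ℝ) T, ∀ i, v t i ≤ C := by
  set M : ℝ → ℝ := fun t => Finset.univ.sup' Finset.univ_nonempty fun j => v t j with hM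
  have hle : ∀ t j, v t j ≤ M t := fun t j =>
    Finset.le_sup' (fun j => v t j) (Finset.mem_univ j)
  have hcont : ContinuousOn M (Icc 0 T) := by
    apply ContinuousOn.finset_sup'_apply
    intro j _ t ht
    exact (hv j t ht).continuousWithinAt
  have key : ∀ ⦃t⦄, t ∈ Icc (0 : ℝ) T → M t ≤ C := by
    apply image_le_of_liminf_slope_right_le_deriv_boundary (B := fun _ => C) (B' := fun _ => 0)
      hcont
    · exact Finset.sup'_le _ _ fun j _ => hC j
    · exact continuousOn_const
    · intro x _
      exact hasDerivWithinAt_const _ _ _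
    · intro x hx r hr
      apply Filter.Eventually.frequently
      have hxI : x ∈ Icc (0 : ℝ) T := ⟨hx.1, hx.2.le⟩
      have hsub : Ioc x T ∈ nhdsWithin x (Ioi x) := Ioc_mem_nhdsGT hx.2
      have hnhds : nhdsWithin x (Ioi x) ≤ nhdsWithin x (Icc 0 T) := by
        apply nhdsWithin_le_of_mem
        filter_upwards [hsub] with z hz
        exact ⟨hx.1.trans hz.1.le, hz.2⟩
      have hall : ∀ j, ∀ᶠ z in nhdsWithin x (Ioi x), v z j < M x + r * (z - x) := by
        intro j
        by_cases hj : v x j = M x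
        · have hd0 : v' x j ≤ 0 := hmax j x hxI fun k => hj ▸ hle x k
          have hd : HasDerivWithinAt (fun s => v s j) (v' x j) (Ioi x) x :=
            (hv j x hxI).mono_of_mem_nhdsWithin (hnhds self_mem_nhdsWithin)
          have hs := (hasDerivWithinAt_iff_tendsto_slope' (by simp)).1 hd
          filter_upwards [hs.eventually (gt_mem_nhds (lt_of_le_of_lt hd0 hr)),
            self_mem_nhdsWithin] with z hz hzx
          have hpos : 0 < z - x := sub_pos.2 hzx
          rw [slope_def_field, div_lt_iff₀ hpos] at hz
          linarith
        · have hlt : v x j < M x := lt_of_le_of_ne (hle x j) hj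
          have hc := ((hv j x hxI).continuousWithinAt.mono_left hnhds).eventually
            (gt_mem_nhds hlt)
          filter_upwards [hc, self_mem_nhdsWithin] with z hz hzx
          have hpos : 0 < z - x := sub_pos.2 hzx
          have := mul_pos hr hpos
          linarith
      filter_upwards [Filter.eventually_all.2 hall, self_mem_nhdsWithin] with z hz hzx
      have hpos : 0 < z - x := sub_pos.2 hzx
      rw [slope_def_field, div_lt_iff₀ hpos]
      have : M z < M x + r * (z - x) := by
        rw [hM]
        exact (Finset.sup'_lt_iff _).2 fun j _ => hz j
      linarith
  intro t ht i
  exact (hle t i).trans (key ht)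

lemma dmp_q_eq_one (a b : ℝ) (hab : a * b ≤ 0) (hne : 0 < |a| + |b|) :
    |b - a| / (|a| + |b|) = 1 := by
  rw [div_eq_one_iff_eq hne.ne']
  rcases mul_nonpos_iff.1 hab with ⟨h1, h2⟩ | ⟨h1, h2⟩
  · rw [abs_of_nonneg h1, abs_of_nonpos h2, abs_of_nonpos (by linarith)]; ring
  · rw [abs_of_nonpos h1, abs_of_nonneg h2, abs_of_nonneg (by linarith)]; ring

lemma dmp_coef (a b : ℝ) : |b + 2 * a| / 6 ≤ 1 / 2 * max |a| |b| := by
  have h1 : |b + 2 * a| ≤ |b| + 2 * |a| := by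
    refine (abs_add_le _ _).trans ?_
    rw [abs_mul, abs_two]
  have := le_max_left |a| |b|
  have := le_max_right |a| |b|
  linarith

/-- **Discrete maximum principle for the mass-lumped Galerkin scheme with
nonlinear artificial viscosity and regularization parameter `ε = 0`.** -/
theorem discrete_maximum_principle_nonlinear_viscosity
    (N : ℕ) [NeZero N] (hN : 3 ≤ N)
    (T ν : ℝ) (hT : 0 < T) (hν : 0 ≤ ν)
    (u u' : ℝ → ZMod N → ℝ)
    (h : ℝ) (hh : h = 1 / N)
    (d : ℝ → ZMod N → ℝ)
    (hd : ∀ t i, d t i = (u t (i + 1) - u t i) / h)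
    (U₀ : ℝ)
    (hU₀ : U₀ = Finset.univ.sup' ⟨(0 : ZMod N), Finset.mem_univ _⟩ fun j => |u 0 j|)
    (ε : ℝ) (hε : ε = 0)
    (q : ℝ → ℝ → ℝ)
    (hq : ∀ a b : ℝ, q a b
      = if 0 < |a| + |b| + ε then |b - a| / (|a| + |b| + ε) else 0)
    (ν₀ : ℝ → ZMod N → ℝ)
    (hν₀ : ∀ t i, ν₀ t i
      = (1 / 2) * max (|u t i|) (|u t (i + 1)|)
          * max (q (d t (i - 1)) (d t i)) (q (d t i) (d t (i + 1))))
    (ξ : ℝ → ZMod N → ℝ)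
    (hξ : ∀ t i, ξ t i
      = if 0 < d t i ∧ d t (i + 1) < d t i ∧ 0 < d t (i + 1)
            ∧ d t (i - 1) ≤ d t i ∧ 0 < d t (i - 1)
        then 1 else 0)
    (ν₁ : ℝ → ZMod N → ℝ)
    (hν₁ : ∀ t i, ν₁ t i
      = ξ t i * max (ν₀ t (i - 1) * d t (i - 1) / d t i)
          (ν₀ t (i + 1) * d t (i + 1) / d t i))
    (νhat : ℝ → ZMod N → ℝ)
    (hνhat : ∀ t i, νhat t i = max ν (h * (ν₀ t i + ν₁ t i)))
    (hderiv : ∀ i, ∀ t ∈ Icc (0 : ℝ) T,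
      HasDerivWithinAt (fun s => u s i) (u' t i) (Icc (0 : ℝ) T) t)
    (hscheme : ∀ i, ∀ t ∈ Icc (0 : ℝ) T,
      h * u' t i
        = -(1 / 6) * (u t (i + 1) ^ 2 + u t i * u t (i + 1)
            - u t i * u t (i - 1) - u t (i - 1) ^ 2)
          + νhat t i * d t i - νhat t (i - 1) * d t (i - 1)) :
    ∀ t ∈ Icc (0 : ℝ) T, ∀ i : ZMod N, |u t i| ≤ U₀ := by
  subst hε
  have hNpos : (0 : ℝ) < N := by exact_mod_cast (by omega : 0 < N)
  have hpos : 0 < h := by rw [hh]; positivity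
  have hq0 : ∀ a b, 0 ≤ q a b := by
    intro a b
    rw [hq]
    split_ifs with hab
    · exact div_nonneg (abs_nonneg _) hab.le
    · exact le_rfl
  have hν₀0 : ∀ t i, 0 ≤ ν₀ t i := by
    intro t i
    rw [hν₀]
    have h1 : 0 ≤ max |u t i| |u t (i + 1)| := le_max_of_le_left (abs_nonneg _)
    have h2 : 0 ≤ max (q (d t (i - 1)) (d t i)) (q (d t i) (d t (i + 1))) :=
      le_max_of_le_left (hq0 _ _)
    positivity
  have hν₁0 : ∀ t i, 0 ≤ ν₁ t i := by
    intro t i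
    rw [hν₁, hξ]
    split_ifs with hc
    · obtain ⟨c1, -, -, -, c5⟩ := hc
      rw [one_mul]
      exact le_max_of_le_left (div_nonneg (mul_nonneg (hν₀0 _ _) c5.le) c1.le)
    · simp
  have hq1 : ∀ a b, a * b ≤ 0 → 0 < |a| + |b| → q a b = 1 := by
    intro a b hab hne
    rw [hq, add_zero, if_pos hne]
    exact dmp_q_eq_one a b hab hne
  -- lower bounds for the viscosity on both sides of an extremum
  have hlow : ∀ t i, 1 ≤ max (q (d t (i - 1)) (d t i)) (q (d t i) (d t (i + 1))) →
      h * (1 / 2 * max |u t i| |u t (i + 1)|) ≤ νhat t i := by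
    intro t i h1
    rw [hνhat]
    refine le_max_of_le_right (mul_le_mul_of_nonneg_left ?_ hpos.le)
    have h2 : 0 ≤ 1 / 2 * max |u t i| |u t (i + 1)| :=
      mul_nonneg (by norm_num) (le_max_of_le_left (abs_nonneg _))
    have h3 := hν₁0 t i
    have h4 : 1 / 2 * max |u t i| |u t (i + 1)| ≤ ν₀ t i := by
      rw [hν₀]
      exact le_mul_of_one_le_right h2 h1
    linarith
  have hR : ∀ t i, d t (i - 1) * d t i ≤ 0 → d t i ≠ 0 →
      h * (|u t (i + 1) + 2 * u t i| / 6) ≤ νhat t i := by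
    intro t i h1 h2
    refine le_trans (mul_le_mul_of_nonneg_left (dmp_coef _ _) hpos.le) (hlow t i ?_)
    refine le_max_of_le_left (hq1 _ _ h1 ?_).ge
    have := abs_pos.2 h2
    positivity
  have hL : ∀ t i, d t (i - 1) * d t i ≤ 0 → d t (i - 1) ≠ 0 →
      h * (|u t (i - 1) + 2 * u t i| / 6) ≤ νhat t (i - 1) := by
    intro t i h1 h2
    have h3 := hlow t (i - 1)
    rw [sub_add_cancel, max_comm |u t (i - 1)|] at h3
    refine le_trans (mul_le_mul_of_nonneg_left (dmp_coef _ _) hpos.le) (h3 ?_)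
    refine le_max_of_le_right (hq1 _ _ h1 ?_).ge
    have := abs_pos.2 h2
    positivity
  have hdR : ∀ t i, u t (i + 1) - u t i = h * d t i := by
    intro t i
    rw [hd]; field_simp
  have hdL : ∀ t i, u t i - u t (i - 1) = h * d t (i - 1) := by
    intro t i
    rw [hd, sub_add_cancel]; field_simp
  have hform : ∀ i, ∀ t ∈ Icc (0 : ℝ) T, h * u' t i
      = (νhat t i - h * ((u t (i + 1) + 2 * u t i) / 6)) * d t i
        - (νhat t (i - 1) + h * ((u t (i - 1) + 2 * u t i) / 6)) * d t (i - 1) := by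
    intro i t ht
    rw [hscheme i t ht]
    linear_combination (-(1 / 6) * (u t (i + 1) + 2 * u t i)) * hdR t i
      + (-(1 / 6) * (u t (i - 1) + 2 * u t i)) * hdL t i
  have hfR : ∀ t i, d t (i - 1) * d t i ≤ 0 → d t i ≠ 0 →
      0 ≤ νhat t i - h * ((u t (i + 1) + 2 * u t i) / 6) := by
    intro t i h1 h2
    have h3 := hR t i h1 h2
    have h4 := mul_le_mul_of_nonneg_left (le_abs_self (u t (i + 1) + 2 * u t i)) hpos.le
    linarith
  have hfL : ∀ t i, d t (i - 1) * d t i ≤ 0 → d t (i - 1) ≠ 0 →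
      0 ≤ νhat t (i - 1) + h * ((u t (i - 1) + 2 * u t i) / 6) := by
    intro t i h1 h2
    have h3 := hL t i h1 h2
    have h4 := mul_le_mul_of_nonneg_left (neg_abs_le (u t (i - 1) + 2 * u t i)) hpos.le
    linarith
  have hup : ∀ i, ∀ t ∈ Icc (0 : ℝ) T, (∀ j, u t j ≤ u t i) → u' t i ≤ 0 := by
    intro i t ht hm
    have h1 : d t i ≤ 0 := by
      rw [hd]; exact div_nonpos_of_nonpos_of_nonneg (sub_nonpos.2 (hm _)) hpos.le
    have h2 : 0 ≤ d t (i - 1) := by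
      rw [hd, sub_add_cancel]; exact div_nonneg (sub_nonneg.2 (hm _)) hpos.le
    have h12 := mul_nonpos_of_nonneg_of_nonpos h2 h1
    have hA : (νhat t i - h * ((u t (i + 1) + 2 * u t i) / 6)) * d t i ≤ 0 := by
      by_cases h0 : d t i = 0
      · simp [h0]
      · exact mul_nonpos_of_nonneg_of_nonpos (hfR t i h12 h0) h1
    have hB : 0 ≤ (νhat t (i - 1) + h * ((u t (i - 1) + 2 * u t i) / 6)) * d t (i - 1) := by
      by_cases h0 : d t (i - 1) = 0
      · simp [h0]
      · exact mul_nonneg (hfL t i h12 h0) h2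
    have hf := hform i t ht
    by_contra hc
    have := mul_pos hpos (not_le.1 hc)
    linarith
  have hdown : ∀ i, ∀ t ∈ Icc (0 : ℝ) T, (∀ j, u t i ≤ u t j) → 0 ≤ u' t i := by
    intro i t ht hm
    have h1 : 0 ≤ d t i := by
      rw [hd]; exact div_nonneg (sub_nonneg.2 (hm _)) hpos.le
    have h2 : d t (i - 1) ≤ 0 := by
      rw [hd, sub_add_cancel]
      exact div_nonpos_of_nonpos_of_nonneg (sub_nonpos.2 (hm _)) hpos.le
    have h12 := mul_nonpos_of_nonpos_of_nonneg h2 h1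
    have hA : 0 ≤ (νhat t i - h * ((u t (i + 1) + 2 * u t i) / 6)) * d t i := by
      by_cases h0 : d t i = 0
      · simp [h0]
      · exact mul_nonneg (hfR t i h12 h0) h1
    have hB : (νhat t (i - 1) + h * ((u t (i - 1) + 2 * u t i) / 6)) * d t (i - 1) ≤ 0 := by
      by_cases h0 : d t (i - 1) = 0
      · simp [h0]
      · exact mul_nonpos_of_nonneg_of_nonpos (hfL t i h12 h0) h2
    have hf := hform i t ht
    by_contra hc
    have := mul_neg_of_pos_of_neg hpos (not_le.1 hc)
    linarith
  have hini : ∀ j, |u 0 j| ≤ U₀ := by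
    intro j
    rw [hU₀]
    exact Finset.le_sup' (fun j => |u 0 j|) (Finset.mem_univ j)
  intro t ht i
  have hU := dmp_max_nonincreasing T u u' hderiv hup U₀
    (fun j => (le_abs_self _).trans (hini j)) t ht i
  have hD := dmp_max_nonincreasing T (fun s j => -u s j) (fun s j => -u' s j)
    (fun i t ht => (hderiv i t ht).fun_neg)
    (fun i t ht hm => neg_nonpos.2 (hdown i t ht fun j => neg_le_neg_iff.1 (hm j))) U₀
    (fun j => (neg_le_abs _).trans (hini j)) t ht i
  exact abs_le'.2 ⟨hU, hD⟩
end

section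
/- Let u : [0,T] → (ℤ/Nℤ → ℝ) solve the mass-lumped Galerkin scheme with linear artificial viscosity. Then the maximum discrete space derivative is nonincreasing: for all t ∈ [0,T], max_i d_i(t) ≤ max_i d_i(0). -/
open Set

/-- Comparison principle for a finite family of differentiable functions. -/
theorem finite_max_le {ι : Type} [Finite ι] (T c K : ℝ) (hK : 0 ≤ K)
    (f f' : ℝ → ι → ℝ)
    (hf : ∀ i, ∀ t ∈ Icc (0 : ℝ) T,
      HasDerivWithinAt (fun s => f s i) (f' t i) (Icc (0 : ℝ) T) t)
    (h0 : ∀ i, f 0 i ≤ c)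
    (hb : ∀ i, ∀ t ∈ Icc (0 : ℝ) T, (∀ j, f t j ≤ f t i) → c < f t i → f t i ≤ c + 1 →
      f' t i ≤ K * (f t i - c)) :
    ∀ t ∈ Icc (0 : ℝ) T, ∀ i, f t i ≤ c := by
  intro t ht i
  by_contra! hlt
  obtain ⟨δ, hδ0, hδ1, hδ2⟩ : ∃ δ : ℝ, 0 < δ ∧ δ ≤ 1 ∧ c + δ < f t i := by
    refine ⟨min 1 ((f t i - c) / 2), lt_min one_pos (by linarith), min_le_left _ _, ?_⟩
    have := min_le_right 1 ((f t i - c) / 2)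
    linarith
  let B : ℝ → ℝ := fun s => c + δ * Real.exp ((K + 1) * (s - T))
  have hB : ∀ s, HasDerivAt B (δ * (Real.exp ((K + 1) * (s - T)) * ((K + 1) * 1))) s := by
    intro s
    exact ((((hasDerivAt_id s).sub_const T).const_mul (K + 1)).exp.const_mul δ).const_add c
  have hBpos : ∀ s, c < B s := fun s => by
    have := mul_pos hδ0 (Real.exp_pos ((K + 1) * (s - T)))
    simp only [B]; linarith
  have hBle : ∀ s ≤ T, B s ≤ c + δ := fun s hs => by
    have : Real.exp ((K + 1) * (s - T)) ≤ 1 := by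
      rw [Real.exp_le_one_iff]
      exact mul_nonpos_of_nonneg_of_nonpos (by linarith) (by linarith)
    simp only [B]; nlinarith
  have key : Icc (0 : ℝ) T ⊆ {s | ∀ j, f s j ≤ B s} := by
    apply IsClosed.Icc_subset_of_forall_mem_nhdsWithin
    · have : {s | ∀ j, f s j ≤ B s} ∩ Icc 0 T
          = (⋂ j, {s ∈ Icc (0 : ℝ) T | f s j ≤ B s}) ∩ Icc 0 T := by
        ext s; simp only [mem_inter_iff, mem_ofPred_eq, mem_iInter]
        exact ⟨fun h => ⟨fun j => ⟨h.2, h.1 j⟩, h.2⟩, fun h => ⟨fun j => (h.1 j).2, h.2⟩⟩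
      rw [this]
      refine (isClosed_iInter fun j => ?_).inter isClosed_Icc
      exact isClosed_Icc.isClosed_le (fun s hs => (hf j s hs).continuousWithinAt)
        (fun s hs => (hB s).continuousAt.continuousWithinAt)
    · intro j; exact (h0 j).trans (hBpos 0).le
    · rintro s ⟨hs, hs0, hsT⟩
      have hsI : s ∈ Icc (0 : ℝ) T := ⟨hs0, hsT.le⟩
      have hev : ∀ᶠ z in nhdsWithin s (Ioi s), ∀ j, f z j ≤ B z := by
        rw [Filter.eventually_all]
        intro j
        have hg : HasDerivWithinAt (fun z => f z j - B z)
            (f' s j - δ * (Real.exp ((K + 1) * (s - T)) * ((K + 1) * 1))) (Ioi s) s := by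
          refine HasDerivWithinAt.sub ?_ (hB s).hasDerivWithinAt
          refine (hf j s hsI).mono_of_mem_nhdsWithin ?_
          filter_upwards [Ioc_mem_nhdsGT hsT] with z hz
          exact ⟨hs0.trans hz.1.le, hz.2⟩
        rcases (hs j).lt_or_eq with hl | he
        · have := hg.continuousWithinAt.eventually (gt_mem_nhds (sub_neg.2 hl))
          filter_upwards [this] with z hz
          linarith
        · have h1 : f' s j ≤ K * (f s j - c) := by
            apply hb j s hsI
            · intro k; rw [he]; exact hs k
            · rw [he]; exact hBpos s
            · rw [he]; linarith [hBle s hsT.le]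
          have hneg : f' s j - δ * (Real.exp ((K + 1) * (s - T)) * ((K + 1) * 1)) < 0 := by
            have h2 := mul_pos hδ0 (Real.exp_pos ((K + 1) * (s - T)))
            rw [he] at h1
            simp only [B] at h1
            nlinarith
          have := hasDerivWithinAt_iff_tendsto_slope.1 hg
          rw [sdiff_singleton_eq_self (by simp)] at this
          filter_upwards [this.eventually (gt_mem_nhds hneg), self_mem_nhdsWithin] with z hz hzs
          rw [slope_def_field, he, sub_self, sub_zero] at hz
          have hzs' : s < z := hzs
          have := (div_neg_iff.1 hz)
          rcases this with h | h
          · linarith [h.2]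
          · linarith [h.1]
      exact hev
  have := key ht i
  linarith [hBle t ht.2]

/-- Nodal algebra for the maximum principle. -/
theorem node_bound (n U M a b : ℝ) (hU : 0 ≤ U) (hn : U / 2 ≤ n) (hM : U < M) (hM1 : M ≤ U + 1)
    (ha : a ≤ M) (hb : b ≤ M) (ha' : -M ≤ a) (hb' : -M ≤ b) :
    -(1 / 6) * (a ^ 2 + M * a - M * b - b ^ 2) + n * (a - M) - n * (M - b)
      ≤ (U + 1) * (M - U) := by
  obtain ⟨A, rfl⟩ : ∃ A, a = M - A := ⟨M - a, by ring⟩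
  obtain ⟨C, rfl⟩ : ∃ C, b = M - C := ⟨M - b, by ring⟩
  have hA : 0 ≤ A := by linarith
  have hC : 0 ≤ C := by linarith
  have e : -(1 / 6) * ((M - A) ^ 2 + M * (M - A) - M * (M - C) - (M - C) ^ 2)
      + n * ((M - A) - M) - n * (M - (M - C))
      = -(n - M / 2) * A - (n + M / 2) * C - A ^ 2 / 6 + C ^ 2 / 6 := by ring
  rw [e]
  have h1 : C * C ≤ C * (2 * M) := mul_le_mul_of_nonneg_left (by linarith) hC
  have h2 : 0 ≤ (n - U / 2) * A := mul_nonneg (by linarith) hA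
  have h3 : (M - U) * A ≤ (M - U) * (2 * (U + 1)) :=
    mul_le_mul_of_nonneg_left (by linarith) (by linarith)
  have h4 : 0 ≤ n * C := mul_nonneg (by linarith) hC
  have h5 : 0 ≤ M * C := mul_nonneg (by linarith) hC
  nlinarith [sq_nonneg A]

/-- Nodal algebra for the gradient bound. -/
theorem slope_bound (n a v w b : ℝ) (hw : w / 2 ≤ n) (hv : -v / 2 ≤ n)
    (hP : b - w ≤ w - v) (hQ : v - a ≤ w - v) :
    (-(1 / 6) * (b ^ 2 + w * b - w * v - v ^ 2) + n * (b - w) - n * (w - v))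
    - (-(1 / 6) * (w ^ 2 + v * w - v * a - a ^ 2) + n * (w - v) - n * (v - a)) ≤ 0 := by
  have h1 := mul_nonneg (sub_nonneg.2 hw) (sub_nonneg.2 hP)
  have h2 := mul_nonneg (sub_nonneg.2 hv) (sub_nonneg.2 hQ)
  nlinarith [sq_nonneg (b - w), sq_nonneg (v - a), sq_nonneg (w - v)]

/-- **The maximum discrete space derivative is nonincreasing for the mass-lumped
Galerkin scheme with linear artificial viscosity.** -/
theorem discrete_gradient_bound_linear_viscosity
    (N : ℕ) [NeZero N] (hN : 3 ≤ N)
    (T ν : ℝ) (hT : 0 < T) (hν : 0 ≤ ν)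
    (u u' : ℝ → ZMod N → ℝ)
    (h : ℝ) (hh : h = 1 / N)
    (d : ℝ → ZMod N → ℝ)
    (hd : ∀ t i, d t i = (u t (i + 1) - u t i) / h)
    (U₀ : ℝ)
    (hU₀ : U₀ = Finset.univ.sup' ⟨(0 : ZMod N), Finset.mem_univ _⟩ fun j => |u 0 j|)
    (νhat : ℝ) (hνhat : νhat = max (U₀ * h / 2) ν)
    (hderiv : ∀ i, ∀ t ∈ Icc (0 : ℝ) T,
      HasDerivWithinAt (fun s => u s i) (u' t i) (Icc (0 : ℝ) T) t)
    (hscheme : ∀ i, ∀ t ∈ Icc (0 : ℝ) T,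
      h * u' t i
        = -(1 / 6) * (u t (i + 1) ^ 2 + u t i * u t (i + 1)
            - u t i * u t (i - 1) - u t (i - 1) ^ 2)
          + νhat * d t i - νhat * d t (i - 1)) :
    ∀ t ∈ Icc (0 : ℝ) T,
      (Finset.univ.sup' ⟨(0 : ZMod N), Finset.mem_univ _⟩ fun i => d t i)
        ≤ Finset.univ.sup' ⟨(0 : ZMod N), Finset.mem_univ _⟩ fun i => d 0 i := by
  have hNpos : (0 : ℝ) < N := by exact_mod_cast (by omega : 0 < N)
  have hpos : 0 < h := by rw [hh]; positivity
  have hU : ∀ j, |u 0 j| ≤ U₀ := fun j => by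
    rw [hU₀]; exact Finset.le_sup' (fun j => |u 0 j|) (Finset.mem_univ j)
  have hU0 : 0 ≤ U₀ := (abs_nonneg _).trans (hU 0)
  obtain ⟨n, hn⟩ : ∃ n, n = νhat / h := ⟨_, rfl⟩
  have hnU : U₀ / 2 ≤ n := by
    rw [hn, le_div_iff₀ hpos, hνhat]
    exact le_trans (by linarith) (le_max_left _ _)
  have hs : ∀ i, ∀ t ∈ Icc (0 : ℝ) T, h * u' t i
        = -(1 / 6) * (u t (i + 1) ^ 2 + u t i * u t (i + 1)
            - u t i * u t (i - 1) - u t (i - 1) ^ 2)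
          + n * (u t (i + 1) - u t i) - n * (u t i - u t (i - 1)) := by
    intro i t ht
    rw [hscheme i t ht, hd, hd, hn, sub_add_cancel]
    ring
  have hmax : ∀ t ∈ Icc (0 : ℝ) T, ∀ p : ZMod N × Bool,
      (if p.2 then u t p.1 else -u t p.1) ≤ U₀ := by
    refine finite_max_le T U₀ ((U₀ + 1) / h) (by positivity)
      (fun t (p : ZMod N × Bool) => if p.2 then u t p.1 else -u t p.1)
      (fun t (p : ZMod N × Bool) => if p.2 then u' t p.1 else -u' t p.1) ?_ ?_ ?_
    · rintro ⟨i, b⟩ t ht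
      cases b
      · simpa using (hderiv i t ht).fun_neg
      · simpa using hderiv i t ht
    · rintro ⟨i, b⟩
      have := abs_le.1 (hU i)
      cases b
      · simp; linarith
      · simp; linarith
    · rintro ⟨i, b⟩ t ht hm hc hc1
      have hp : ∀ j, u t j ≤ _ := fun j => by simpa using hm (j, true)
      have hq : ∀ j, -u t j ≤ _ := fun j => by simpa using hm (j, false)
      rw [div_mul_eq_mul_div, le_div_iff₀ hpos]
      cases b
      · simp only [Bool.false_eq_true, if_false] at hp hq hc hc1 ⊢
        have := node_bound n U₀ (-u t i) (-u t (i - 1)) (-u t (i + 1)) hU0 hnU hc hc1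
          (hq _) (hq _) (by linarith [hp (i - 1)]) (by linarith [hp (i + 1)])
        have e := hs i t ht
        linarith
      · simp only [if_true] at hp hq hc hc1 ⊢
        have := node_bound n U₀ (u t i) (u t (i + 1)) (u t (i - 1)) hU0 hnU hc hc1
          (hp _) (hp _) (by linarith [hq (i + 1)]) (by linarith [hq (i - 1)])
        have e := hs i t ht
        linarith
  intro t ht
  refine Finset.sup'_le _ _ fun i _ => ?_
  refine finite_max_le T _ 0 le_rfl d (fun t i => (u' t (i + 1) - u' t i) / h) ?_ ?_ ?_ t ht i
  · intro i t ht
    have : (fun s => d s i) = fun s => (u s (i + 1) - u s i) / h := by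
      funext s; exact hd s i
    rw [this]
    exact ((hderiv (i + 1) t ht).fun_sub (hderiv i t ht)).div_const h
  · intro i
    exact Finset.le_sup' (fun i => d 0 i) (Finset.mem_univ i)
  · intro i t ht hm _ _
    rw [zero_mul]
    refine div_nonpos_of_nonpos_of_nonneg ?_ hpos.le
    have e1 := hs (i + 1) t ht
    have e2 := hs i t ht
    have m1 := hm (i + 1)
    have m2 := hm (i - 1)
    rw [hd, hd, div_le_div_iff_of_pos_right hpos] at m1 m2
    rw [sub_add_cancel] at m2
    rw [add_sub_cancel_right] at e1
    have b1 : u t (i + 1) ≤ U₀ := by simpa using hmax t ht (i + 1, true)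
    have b2 : -u t i ≤ U₀ := by simpa using hmax t ht (i, false)
    have := slope_bound n (u t (i - 1)) (u t i) (u t (i + 1)) (u t (i + 1 + 1))
      (by linarith) (by linarith) m1 m2
    rw [← e1, ← e2] at this
    by_contra! hc
    nlinarith
end

section
/- Let u : [0,T] → (ℤ/Nℤ → ℝ) solve the mass-lumped Galerkin scheme with linear artificial viscosity. Then the total variation of the discrete solution is nonincreasing: for all t ∈ [0,T], TV(u(t)) := ∑_{i ∈ ℤ/Nℤ} |u_{i+1}(t) − u_i(t)| ≤ ∑_{i ∈ ℤ/Nℤ} |u_{i+1}(0) − u_i(0)| = TV(u(0)). -/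
open Set

/-- First crossing lemma for a finite family of functions. -/
theorem first_crossing {ι : Type*} [Finite ι] (T : ℝ) (g g' : ℝ → ι → ℝ)
    (hg : ∀ k, ∀ t ∈ Icc (0 : ℝ) T,
      HasDerivWithinAt (fun s => g s k) (g' t k) (Icc (0 : ℝ) T) t)
    (h0 : ∀ k, g 0 k < 0)
    (hc : ∀ t ∈ Icc (0 : ℝ) T, ∀ k, (∀ j, g t j ≤ 0) → g t k = 0 → g' t k < 0) :
    ∀ t ∈ Icc (0 : ℝ) T, ∀ k, g t k < 0 := by
  intro t ht k
  by_contra hcon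
  push Not at hcon
  have hcont : ∀ k, ContinuousOn (fun s => g s k) (Icc 0 T) :=
    fun k s hs => (hg k s hs).continuousWithinAt
  let S : Set ℝ := ⋃ k, (Icc (0 : ℝ) T ∩ (fun s => g s k) ⁻¹' Ici 0)
  have hSc : IsClosed S :=
    isClosed_iUnion_of_finite fun k => (hcont k).preimage_isClosed_of_isClosed isClosed_Icc isClosed_Ici
  have hSne : S.Nonempty := ⟨t, mem_iUnion.2 ⟨k, ht, hcon⟩⟩
  have hSb : BddBelow S := ⟨0, fun s hs => by
    obtain ⟨k, hk, -⟩ := mem_iUnion.1 hs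
    exact hk.1⟩
  have hmem := hSc.csInf_mem hSne hSb
  set t0 := sInf S with ht0
  obtain ⟨k0, ht0I, hk0⟩ := mem_iUnion.1 hmem
  have hk0 : 0 ≤ g t0 k0 := hk0
  have hlt : ∀ s ∈ Ico 0 t0, ∀ j, g s j < 0 := by
    intro s hs j
    by_contra hj
    push Not at hj
    have : t0 ≤ s := csInf_le hSb (mem_iUnion.2 ⟨j, ⟨hs.1, hs.2.le.trans ht0I.2⟩, hj⟩)
    linarith [hs.2]
  have hpos : 0 < t0 := by
    rcases ht0I.1.eq_or_lt with h | h
    · rw [← h] at hk0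
      linarith [h0 k0]
    · exact h
  have hsub : Ico 0 t0 ⊆ Icc 0 T := fun s hs => ⟨hs.1, hs.2.le.trans ht0I.2⟩
  have hne : (nhdsWithin t0 (Ico 0 t0)).NeBot := by
    rw [← mem_closure_iff_nhdsWithin_neBot, closure_Ico hpos.ne]
    exact ⟨hpos.le, le_rfl⟩
  have hle : ∀ j, g t0 j ≤ 0 := by
    intro j
    have h1 := ((hcont j) t0 ht0I).mono hsub
    refine le_of_tendsto h1 ?_
    filter_upwards [self_mem_nhdsWithin] with s hs using (hlt s hs j).le
  have h0' := le_antisymm (hle k0) hk0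
  have hneg := hc t0 ht0I k0 hle h0'
  have hd := (hg k0 t0 ht0I).mono hsub
  rw [hasDerivWithinAt_iff_tendsto_slope' (by simp)] at hd
  have : 0 ≤ g' t0 k0 := by
    refine ge_of_tendsto hd ?_
    filter_upwards [self_mem_nhdsWithin] with s hs
    rw [slope_def_field]
    have h1 := hlt s hs k0
    apply div_nonneg_of_nonpos <;> linarith [hs.2]
  linarith

theorem crossing_alg (p q r S M e c U : ℝ) (hq : q = M) (hp : |p| ≤ M) (hr : |r| ≤ M)
    (hS : |S| ≤ 3 * M) (hM : M = U + e) (he : 0 < e) (hcU : U / 2 ≤ c) :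
    (r - q) * (c - S / 6) - (q - p) * (c + S / 6) ≤ 2 * M * e := by
  rw [abs_le] at *
  have h1 : 0 ≤ (q - r) * (c - S / 6 + e / 2) := mul_nonneg (by linarith) (by linarith)
  have h2 : 0 ≤ (q - p) * (c + S / 6 + e / 2) := mul_nonneg (by linarith) (by linarith)
  have h3 : 0 ≤ (2 * M + r + (2 * M + p) - 2 * M) * e := mul_nonneg (by linarith) he.le
  subst hq
  nlinarith

/-- The maximum principle. -/
theorem max_principle (N : ℕ) [NeZero N] (T h c U : ℝ) (hh : 0 < h) (hcU : U / 2 ≤ c)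
    (u u' : ℝ → ZMod N → ℝ)
    (hderiv : ∀ i, ∀ t ∈ Icc (0 : ℝ) T,
      HasDerivWithinAt (fun s => u s i) (u' t i) (Icc (0 : ℝ) T) t)
    (h0 : ∀ i, |u 0 i| ≤ U)
    (hs : ∀ i, ∀ t ∈ Icc (0 : ℝ) T, h * u' t i =
      (u t (i + 1) - u t i) * (c - (u t (i + 1) + u t i + u t (i - 1)) / 6)
      - (u t i - u t (i - 1)) * (c + (u t (i + 1) + u t i + u t (i - 1)) / 6)) :
    ∀ t ∈ Icc (0 : ℝ) T, ∀ i, |u t i| ≤ U := by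
  have hbd : ∀ i, ∃ C, ∀ t ∈ Icc (0 : ℝ) T, |u t i| ≤ C := by
    intro i
    have hc : ContinuousOn (fun s => u s i) (Icc 0 T) :=
      fun s hs => (hderiv i s hs).continuousWithinAt
    obtain ⟨C, hC⟩ := isCompact_Icc.exists_bound_of_continuousOn hc
    exact ⟨C, fun t ht => hC t ht⟩
  choose C hC using hbd
  obtain ⟨C0, hC0⟩ : ∃ C0, ∀ i, C i ≤ C0 :=
    ⟨Finset.univ.sup' ⟨0, Finset.mem_univ _⟩ C, fun i => Finset.le_sup' C (Finset.mem_univ i)⟩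
  set K := (2 * C0 + 1) / h with hK
  have hKh : h * K = 2 * C0 + 1 := by rw [hK]; field_simp
  have key : ∀ ε > 0, ∀ t ∈ Icc (0 : ℝ) T, ∀ i, |u t i| ≤ U + ε * Real.exp (K * t) := by
    intro ε hε
    have hf := first_crossing (ι := ZMod N × Bool) T
      (fun t k => (if k.2 then u t k.1 else - u t k.1) - (U + ε * Real.exp (K * t)))
      (fun t k => (if k.2 then u' t k.1 else - u' t k.1) - (ε * (Real.exp (K * t) * K)))
      ?_ ?_ ?_
    · intro t ht i
      have h1 := hf t ht (i, true)
      have h2 := hf t ht (i, false)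
      simp at h1 h2
      rw [abs_le]
      constructor <;> linarith
    · rintro ⟨i, b⟩ t ht
      have he : HasDerivAt (fun s => U + ε * Real.exp (K * s)) (ε * (Real.exp (K * t) * K)) t := by
        have h1 : HasDerivAt (fun s => K * s) K t := by
          simpa using (hasDerivAt_id t).const_mul K
        exact (h1.exp.const_mul ε).const_add U
      cases b
      · simpa using (hderiv i t ht).fun_neg.fun_sub he.hasDerivWithinAt
      · simpa using (hderiv i t ht).fun_sub he.hasDerivWithinAt
    · rintro ⟨i, b⟩
      have := abs_le.1 (h0 i)
      cases b <;> simp <;> linarith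
    · rintro t ht ⟨i, b⟩ hle heq
      set e := ε * Real.exp (K * t) with he
      have hepos : 0 < e := by positivity
      have habs : ∀ j, |u t j| ≤ U + e := by
        intro j
        have h1 := hle (j, true)
        have h2 := hle (j, false)
        simp at h1 h2
        rw [abs_le]
        constructor <;> linarith
      have hS : |u t (i + 1) + u t i + u t (i - 1)| ≤ 3 * (U + e) := by
        have h1 := abs_le.1 (habs (i + 1))
        have h2 := abs_le.1 (habs i)
        have h3 := abs_le.1 (habs (i - 1))
        rw [abs_le]
        constructor <;> linarith
      have hui := abs_le.1 ((hC i t ht).trans (hC0 i))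
      have heq2 := hs i t ht
      have hre : ε * (Real.exp (K * t) * K) = e * K := by rw [he]; ring
      cases b
      · simp at heq
        simp only [Bool.false_eq_true, if_false, hre]
        have ha := crossing_alg (-u t (i - 1)) (-u t i) (-u t (i + 1))
          (-(u t (i + 1) + u t i + u t (i - 1))) (U + e) e c U (by linarith)
          (by simpa using habs _) (by simpa using habs _) (by rw [abs_neg]; exact hS) rfl hepos hcU
        have hb := crossing_alg (-u t (i - 1)) (-u t i) (-u t (i + 1))
          (u t (i + 1) + u t i + u t (i - 1)) (U + e) e c U (by linarith)
          (by simpa using habs _) (by simpa using habs _) hS rfl hepos hcU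
        have hM : (U + e) * e ≤ C0 * e := mul_le_mul_of_nonneg_right (by linarith) hepos.le
        have : h * (-u' t i - e * K) < 0 := by
          have : h * (-u' t i - e * K) = -(h * u' t i) - e * (h * K) := by ring
          rw [this, hKh, heq2]
          nlinarith
        exact (pos_iff_neg_of_mul_neg this).1 hh
      · simp at heq
        simp only [if_true, hre]
        have hb := crossing_alg (u t (i - 1)) (u t i) (u t (i + 1))
          (u t (i + 1) + u t i + u t (i - 1)) (U + e) e c U (by linarith)
          (habs _) (habs _) hS rfl hepos hcU
        have hM : (U + e) * e ≤ C0 * e := mul_le_mul_of_nonneg_right (by linarith) hepos.le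
        have : h * (u' t i - e * K) < 0 := by
          have : h * (u' t i - e * K) = (h * u' t i) - e * (h * K) := by ring
          rw [this, hKh, heq2]
          nlinarith
        exact (pos_iff_neg_of_mul_neg this).1 hh
  intro t ht i
  refine le_of_forall_pos_le_add fun δ hδ => ?_
  have := key (δ / Real.exp (K * t)) (by positivity) t ht i
  rwa [div_mul_cancel₀ _ (Real.exp_pos _).ne'] at this

/-- Derivative of the regularised absolute value: near-monotonicity. -/
theorem reg_alg (ε x y : ℝ) (hε : 0 < ε) :
    x * (y / √(y ^ 2 + ε ^ 2) - x / √(x ^ 2 + ε ^ 2)) ≤ ε := by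
  have hx : 0 < √(x ^ 2 + ε ^ 2) := Real.sqrt_pos.2 (by positivity)
  have hy : 0 < √(y ^ 2 + ε ^ 2) := Real.sqrt_pos.2 (by positivity)
  have hyl : |y| ≤ √(y ^ 2 + ε ^ 2) := Real.abs_le_sqrt (by nlinarith)
  have hxl : |x| ≤ √(x ^ 2 + ε ^ 2) := Real.abs_le_sqrt (by nlinarith)
  have hsx : √(x ^ 2 + ε ^ 2) ^ 2 = x ^ 2 + ε ^ 2 := Real.sq_sqrt (by positivity)
  have hxe : √(x ^ 2 + ε ^ 2) ≤ |x| + ε := by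
    apply Real.sqrt_le_iff.2 ⟨by positivity, ?_⟩
    nlinarith [sq_abs x, abs_nonneg x]
  have h1 : x * (y / √(y ^ 2 + ε ^ 2)) ≤ |x| := by
    refine (le_abs_self _).trans ?_
    rw [abs_mul, abs_div, abs_of_pos hy]
    exact mul_le_of_le_one_right (abs_nonneg _) ((div_le_one hy).2 hyl)
  have h2 : |x| - ε ≤ x * (x / √(x ^ 2 + ε ^ 2)) := by
    rw [← mul_div_assoc, le_div_iff₀ hx]
    set s := √(x ^ 2 + ε ^ 2)
    nlinarith [sq_abs x, abs_nonneg x]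
  linarith

theorem tv_reg (N : ℕ) [NeZero N] (ε : ℝ) (hε : 0 < ε) (A B D φ : ZMod N → ℝ) (c : ℝ)
    (hA : ∀ i, 0 ≤ A i) (hB : ∀ i, 0 ≤ B i) (hAB : ∀ i, A i + B i = c)
    (hφ : ∀ i, φ i = D i / √(D i ^ 2 + ε ^ 2)) :
    ∑ i, φ i * ((A (i + 1) * D (i + 1) - B (i + 1) * D i) - (A i * D i - B i * D (i - 1)))
      ≤ N * (c * ε) := by
  have e1 : ∑ i, φ i * (A (i + 1) * D (i + 1)) = ∑ i, φ (i - 1) * (A i * D i) := by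
    rw [← Equiv.sum_comp (Equiv.addRight (1 : ZMod N)) (fun i => φ (i - 1) * (A i * D i))]
    simp
  have e2 : ∑ i, φ i * (B (i + 1) * D i) = ∑ i, φ (i - 1) * (B i * D (i - 1)) := by
    rw [← Equiv.sum_comp (Equiv.addRight (1 : ZMod N)) (fun i => φ (i - 1) * (B i * D (i - 1)))]
    simp
  have : ∑ i, φ i * ((A (i + 1) * D (i + 1) - B (i + 1) * D i) - (A i * D i - B i * D (i - 1)))
      = ∑ i, (A i * (D i * (φ (i - 1) - φ i)) + B i * (D (i - 1) * (φ i - φ (i - 1)))) := by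
    have : ∀ i, φ i * ((A (i + 1) * D (i + 1) - B (i + 1) * D i) - (A i * D i - B i * D (i - 1)))
      = φ i * (A (i + 1) * D (i + 1)) - φ i * (B (i + 1) * D i)
        - φ i * (A i * D i) + φ i * (B i * D (i - 1)) := fun i => by ring
    simp_rw [this]
    rw [Finset.sum_add_distrib, Finset.sum_sub_distrib, Finset.sum_sub_distrib, e1, e2,
      ← Finset.sum_sub_distrib, ← Finset.sum_sub_distrib, ← Finset.sum_add_distrib]
    exact Finset.sum_congr rfl fun i _ => by ring
  rw [this]
  have hb : ∀ i ∈ (Finset.univ : Finset (ZMod N)),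
      A i * (D i * (φ (i - 1) - φ i)) + B i * (D (i - 1) * (φ i - φ (i - 1))) ≤ c * ε := by
    intro i _
    have h1 := reg_alg ε (D i) (D (i - 1)) hε
    have h2 := reg_alg ε (D (i - 1)) (D i) hε
    rw [← hφ, ← hφ] at h1 h2
    have h3 := mul_le_mul_of_nonneg_left h1 (hA i)
    have h4 := mul_le_mul_of_nonneg_left h2 (hB i)
    rw [← hAB i]
    linarith
  simpa [ZMod.card] using Finset.sum_le_card_nsmul _ _ _ hb

/-- **The total variation of the discrete solution of the mass-lumped Galerkin
scheme with linear artificial viscosity is nonincreasing.** -/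
theorem discrete_total_variation_diminishing_linear_viscosity
    (N : ℕ) [NeZero N] (hN : 3 ≤ N)
    (T ν : ℝ) (hT : 0 < T) (hν : 0 ≤ ν)
    (u u' : ℝ → ZMod N → ℝ)
    (h : ℝ) (hh : h = 1 / N)
    (d : ℝ → ZMod N → ℝ)
    (hd : ∀ t i, d t i = (u t (i + 1) - u t i) / h)
    (U₀ : ℝ)
    (hU₀ : U₀ = Finset.univ.sup' ⟨(0 : ZMod N), Finset.mem_univ _⟩ fun j => |u 0 j|)
    (νhat : ℝ) (hνhat : νhat = max (U₀ * h / 2) ν)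
    (hderiv : ∀ i, ∀ t ∈ Icc (0 : ℝ) T,
      HasDerivWithinAt (fun s => u s i) (u' t i) (Icc (0 : ℝ) T) t)
    (hscheme : ∀ i, ∀ t ∈ Icc (0 : ℝ) T,
      h * u' t i
        = -(1 / 6) * (u t (i + 1) ^ 2 + u t i * u t (i + 1)
            - u t i * u t (i - 1) - u t (i - 1) ^ 2)
          + νhat * d t i - νhat * d t (i - 1)) :
    ∀ t ∈ Icc (0 : ℝ) T,
      ∑ i : ZMod N, |u t (i + 1) - u t i| ≤ ∑ i : ZMod N, |u 0 (i + 1) - u 0 i| := by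
  have hNpos : (0 : ℝ) < N := by exact_mod_cast (by omega : 0 < N)
  have hpos : 0 < h := by rw [hh]; positivity
  set c := νhat / h with hc
  have h0 : ∀ i, |u 0 i| ≤ U₀ := by
    intro i
    rw [hU₀]
    exact Finset.le_sup' (fun j => |u 0 j|) (Finset.mem_univ i)
  have hcU : U₀ / 2 ≤ c := by
    rw [hc, le_div_iff₀ hpos, hνhat]
    exact le_trans (by linarith) (le_max_left _ _)
  have hs : ∀ i, ∀ t ∈ Icc (0 : ℝ) T, h * u' t i =
      (u t (i + 1) - u t i) * (c - (u t (i + 1) + u t i + u t (i - 1)) / 6)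
      - (u t i - u t (i - 1)) * (c + (u t (i + 1) + u t i + u t (i - 1)) / 6) := by
    intro i t ht
    rw [hscheme i t ht, hd, hd, sub_add_cancel]
    have e1 : ∀ x, νhat * (x / h) = c * x := fun x => by rw [hc]; ring
    rw [e1, e1]
    ring
  have hmax := max_principle N T h c U₀ hpos hcU u u' hderiv h0 hs
  intro t ht
  have key : ∀ ε > 0, ∑ i : ZMod N, |u t (i + 1) - u t i|
      ≤ ∑ i : ZMod N, |u 0 (i + 1) - u 0 i| + (N + N * (2 * c) / h * t) * ε := by
    intro ε hε
    let W : ℝ → ℝ := fun s => ∑ i : ZMod N, √((u s (i + 1) - u s i) ^ 2 + ε ^ 2)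
    have hW : ∀ s ∈ Icc (0 : ℝ) T, HasDerivWithinAt W
        (∑ i : ZMod N, (u s (i + 1) - u s i) / √((u s (i + 1) - u s i) ^ 2 + ε ^ 2)
          * (u' s (i + 1) - u' s i)) (Icc 0 T) s := by
      intro s hs
      refine HasDerivWithinAt.fun_sum fun i _ => ?_
      have h1 := (((hderiv (i + 1) s hs).fun_sub (hderiv i s hs)).fun_pow 2).add_const (ε ^ 2)
      have h2 := h1.sqrt (by positivity)
      refine h2.congr_deriv ?_
      norm_num
      field_simp
    have hWle : ∀ s ∈ Icc (0 : ℝ) T,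
        (∑ i : ZMod N, (u s (i + 1) - u s i) / √((u s (i + 1) - u s i) ^ 2 + ε ^ 2)
          * (u' s (i + 1) - u' s i)) ≤ N * (2 * c) / h * ε := by
      intro s hsI
      have hS : ∀ i, |u s (i + 1) + u s i + u s (i - 1)| ≤ 3 * U₀ := by
        intro i
        have h1 := abs_le.1 (hmax s hsI (i + 1))
        have h2 := abs_le.1 (hmax s hsI i)
        have h3 := abs_le.1 (hmax s hsI (i - 1))
        rw [abs_le]
        constructor <;> linarith
      have := tv_reg N ε hε (fun i => c - (u s (i + 1) + u s i + u s (i - 1)) / 6)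
        (fun i => c + (u s (i + 1) + u s i + u s (i - 1)) / 6)
        (fun i => u s (i + 1) - u s i)
        (fun i => (u s (i + 1) - u s i) / √((u s (i + 1) - u s i) ^ 2 + ε ^ 2)) (2 * c)
        (fun i => by have := abs_le.1 (hS i); linarith)
        (fun i => by have := abs_le.1 (hS i); linarith)
        (fun i => by ring) (fun i => rfl)
      have e : N * (2 * c) / h * ε = (N * (2 * c * ε)) / h := by ring
      rw [e, le_div_iff₀ hpos, Finset.sum_mul]
      refine le_trans (le_of_eq (Finset.sum_congr rfl fun i _ => ?_)) this
      have h1 := hs (i + 1) s hsI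
      have h2 := hs i s hsI
      have e3 : i + 1 - 1 = i := by ring
      have e4 : i - 1 + 1 = i := by ring
      simp only [e3, e4] at h1 h2 ⊢
      rw [mul_assoc, sub_mul, mul_comm _ h, mul_comm _ h, h1, h2]
      ring
    have hanti : AntitoneOn (fun s => W s - N * (2 * c) / h * ε * s) (Icc 0 T) := by
      have hder : ∀ s ∈ Icc (0 : ℝ) T, HasDerivWithinAt
          (fun s => W s - N * (2 * c) / h * ε * s) _ (Icc 0 T) s := fun s hs =>
        (hW s hs).fun_sub ((hasDerivWithinAt_id s _).const_mul (N * (2 * c) / h * ε))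
      refine antitoneOn_of_hasDerivWithinAt_nonpos (convex_Icc 0 T)
        (fun s hs => (hder s hs).continuousWithinAt)
        (fun s hs => (hder s (interior_subset hs)).mono interior_subset) ?_
      intro s hs
      have := hWle s (interior_subset hs)
      linarith
    have h1 := hanti ⟨le_rfl, hT.le⟩ ht ht.1
    simp only [mul_zero, sub_zero] at h1
    have h2 : ∑ i : ZMod N, |u t (i + 1) - u t i| ≤ W t :=
      Finset.sum_le_sum fun i _ => Real.abs_le_sqrt (by nlinarith)
    have h3 : W 0 ≤ ∑ i : ZMod N, (|u 0 (i + 1) - u 0 i| + ε) := by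
      refine Finset.sum_le_sum fun i _ => Real.sqrt_le_iff.2 ⟨by positivity, ?_⟩
      nlinarith [sq_abs (u 0 (i + 1) - u 0 i), abs_nonneg (u 0 (i + 1) - u 0 i)]
    rw [Finset.sum_add_distrib] at h3
    simp [ZMod.card] at h3
    linarith
  have hlim : Filter.Tendsto (fun ε : ℝ => ∑ i : ZMod N, |u 0 (i + 1) - u 0 i|
      + (N + N * (2 * c) / h * t) * ε) (nhdsWithin 0 (Ioi 0))
      (nhds (∑ i : ZMod N, |u 0 (i + 1) - u 0 i|)) := by
    have : Continuous (fun ε : ℝ => ∑ i : ZMod N, |u 0 (i + 1) - u 0 i|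
      + (N + N * (2 * c) / h * t) * ε) := by fun_prop
    simpa using (this.tendsto 0).mono_left nhdsWithin_le_nhds
  exact ge_of_tendsto hlim (by filter_upwards [self_mem_nhdsWithin] with ε hε using key ε hε)
end

section
/- Let ε > 0 with ε·T < 1, and let u : [0,T] → (ℤ/Nℤ → ℝ) solve the mass-lumped Galerkin scheme with nonlinear artificial viscosity and regularization parameter ε. Then the perturbed discrete maximum principle holds: for all t ∈ [0,T] and all i, |u_i(t)| ≤ (1 + ε·T)·U₀, where U₀ := max_j |u_j(0)|. -/
open Set

/-- The pointwise bound at a maximal node. -/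
lemma node_bound_s12 (h ε a b c V1 V2 : ℝ) (hh : 0 < h) (hε : 0 < ε)
    (hb : |b| ≤ a) (hc : |c| ≤ a)
    (hV1 : h * (1 / 2 * a * (((a - b) / h + (a - c) / h) / ((a - b) / h + (a - c) / h + ε))) ≤ V1)
    (hV2 : h * (1 / 2 * a * (((a - b) / h + (a - c) / h) / ((a - b) / h + (a - c) / h + ε))) ≤ V2) :
    -(1 / 6) * (b ^ 2 + a * b - a * c - c ^ 2) - V1 * ((a - b) / h) - V2 * ((a - c) / h)
      ≤ h * (ε / 2 * a) := by
  obtain ⟨hb1, hb2⟩ := abs_le.1 hb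
  obtain ⟨hc1, hc2⟩ := abs_le.1 hc
  have ha : 0 ≤ a := (abs_nonneg _).trans hb
  obtain ⟨P, hP⟩ : ∃ P, P = (a - b) / h := ⟨_, rfl⟩
  obtain ⟨R, hR⟩ : ∃ R, R = (a - c) / h := ⟨_, rfl⟩
  have hP0 : 0 ≤ P := hP ▸ div_nonneg (by linarith) hh.le
  have hR0 : 0 ≤ R := hR ▸ div_nonneg (by linarith) hh.le
  have hbP : b = a - h * P := by rw [hP]; field_simp; ring
  have hcR : c = a - h * R := by rw [hR]; field_simp; ring
  rw [← hP, ← hR] at hV1 hV2 ⊢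
  obtain ⟨Q, hQ⟩ : ∃ Q, Q = (P + R) / (P + R + ε) := ⟨_, rfl⟩
  rw [← hQ] at hV1 hV2
  have hD : 0 < P + R + ε := by positivity
  have hQe : (P + R) - Q * (P + R) ≤ ε := by
    have : (P + R) - Q * (P + R) = ε * ((P + R) / (P + R + ε)) := by
      rw [hQ]; field_simp; ring
    rw [this]
    have : (P + R) / (P + R + ε) ≤ 1 := by rw [div_le_one hD]; linarith
    nlinarith
  have h1 : h * (1 / 2 * a * Q) * P ≤ V1 * P := mul_le_mul_of_nonneg_right hV1 hP0
  have h2 : h * (1 / 2 * a * Q) * R ≤ V2 * R := mul_le_mul_of_nonneg_right hV2 hR0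
  have h3 : h * a / 2 * ((P + R) - Q * (P + R)) ≤ h * a / 2 * ε :=
    mul_le_mul_of_nonneg_left hQe (by positivity)
  have h4 : -(1 / 6) * (b ^ 2 + a * b - a * c - c ^ 2) ≤ h * a / 2 * (P + R) := by
    have e : -(1 / 6) * (b ^ 2 + a * b - a * c - c ^ 2)
        = h / 6 * (P * (a + b + c) - R * (a + b + c)) := by
      have : -(1 / 6) * (b ^ 2 + a * b - a * c - c ^ 2) = 1 / 6 * ((c - b) * (a + b + c)) := by ring
      have e2 : c - b = h * (P - R) := by rw [hbP, hcR]; ring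
      rw [this, e2]; ring
    have k1 : P * (a + b + c) ≤ P * (3 * a) := mul_le_mul_of_nonneg_left (by linarith) hP0
    have k2 : R * (-(a + b + c)) ≤ R * (3 * a) := mul_le_mul_of_nonneg_left (by linarith) hR0
    rw [e]
    have : h / 6 * (P * (a + b + c) - R * (a + b + c)) ≤ h / 6 * (P * (3 * a) + R * (3 * a)) :=
      mul_le_mul_of_nonneg_left (by linarith) (by positivity)
    linarith
  linarith

/-- A differentiable function starting below `M` with slope less than `r`, when it touches `M`,
stays below the line `M + r (z - x)` for a short time. -/
lemma eventually_lt_line (T x M r f' : ℝ) (f : ℝ → ℝ) (hx : x ∈ Ico 0 T) (hr : 0 < r)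
    (hf : HasDerivWithinAt f f' (Icc 0 T) x) (hM : f x ≤ M) (hfr : f x = M → f' < r) :
    ∀ᶠ z in nhdsWithin x (Ioi x), f z < M + r * (z - x) := by
  have hf2 : HasDerivWithinAt f f' (Ioi x) x := by
    refine hf.mono_of_mem_nhdsWithin ?_
    exact mem_nhdsWithin.2 ⟨Iio T, isOpen_Iio, hx.2, fun z hz => ⟨hx.1.trans (le_of_lt hz.2), le_of_lt hz.1⟩⟩
  rcases hM.lt_or_eq with hlt | heq
  · filter_upwards [hf2.continuousWithinAt.eventually (gt_mem_nhds hlt), self_mem_nhdsWithin] with z hz hz2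
    have : 0 < z - x := sub_pos.2 hz2
    nlinarith
  · have := (hasDerivWithinAt_iff_tendsto_slope' self_notMem_Ioi).1 hf2
    filter_upwards [this.eventually (gt_mem_nhds (hfr heq)), self_mem_nhdsWithin] with z hz hz2
    have h0 : 0 < z - x := sub_pos.2 hz2
    rw [slope_def_field, div_lt_iff₀ h0] at hz
    linarith

/-- **Perturbed discrete maximum principle for the mass-lumped Galerkin scheme
with nonlinear artificial viscosity and regularization parameter `ε > 0`,
`εT < 1`:** the maximum principle is violated by at most a factor `1 + εT`. -/
theorem discrete_maximum_principle_regularized_nonlinear_viscosity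
    (N : ℕ) [NeZero N] (hN : 3 ≤ N)
    (T ν : ℝ) (hT : 0 < T) (hν : 0 ≤ ν)
    (u u' : ℝ → ZMod N → ℝ)
    (h : ℝ) (hh : h = 1 / N)
    (d : ℝ → ZMod N → ℝ)
    (hd : ∀ t i, d t i = (u t (i + 1) - u t i) / h)
    (U₀ : ℝ)
    (hU₀ : U₀ = Finset.univ.sup' ⟨(0 : ZMod N), Finset.mem_univ _⟩ fun j => |u 0 j|)
    (ε : ℝ) (hε : 0 < ε) (hεT : ε * T < 1)
    (q : ℝ → ℝ → ℝ)
    (hq : ∀ a b : ℝ, q a b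
      = if 0 < |a| + |b| + ε then |b - a| / (|a| + |b| + ε) else 0)
    (ν₀ : ℝ → ZMod N → ℝ)
    (hν₀ : ∀ t i, ν₀ t i
      = (1 / 2) * max (|u t i|) (|u t (i + 1)|)
          * max (q (d t (i - 1)) (d t i)) (q (d t i) (d t (i + 1))))
    (ξ : ℝ → ZMod N → ℝ)
    (hξ : ∀ t i, ξ t i
      = if 0 < d t i ∧ d t (i + 1) < d t i ∧ 0 < d t (i + 1)
            ∧ d t (i - 1) ≤ d t i ∧ 0 < d t (i - 1)
        then 1 else 0)
    (ν₁ : ℝ → ZMod N → ℝ)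
    (hν₁ : ∀ t i, ν₁ t i
      = ξ t i * max (ν₀ t (i - 1) * d t (i - 1) / d t i)
          (ν₀ t (i + 1) * d t (i + 1) / d t i))
    (νhat : ℝ → ZMod N → ℝ)
    (hνhat : ∀ t i, νhat t i = max ν (h * (ν₀ t i + ν₁ t i)))
    (hderiv : ∀ i, ∀ t ∈ Icc (0 : ℝ) T,
      HasDerivWithinAt (fun s => u s i) (u' t i) (Icc (0 : ℝ) T) t)
    (hscheme : ∀ i, ∀ t ∈ Icc (0 : ℝ) T,
      h * u' t i
        = -(1 / 6) * (u t (i + 1) ^ 2 + u t i * u t (i + 1)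
            - u t i * u t (i - 1) - u t (i - 1) ^ 2)
          + νhat t i * d t i - νhat t (i - 1) * d t (i - 1)) :
    ∀ t ∈ Icc (0 : ℝ) T, ∀ i : ZMod N, |u t i| ≤ (1 + ε * T) * U₀ := by
  have hNpos : (0 : ℝ) < N := by exact_mod_cast (by omega : 0 < N)
  have hh0 : 0 < h := by rw [hh]; positivity
  have hq' : ∀ a b, q a b = |b - a| / (|a| + |b| + ε) := fun a b => by
    rw [hq, if_pos (by positivity)]
  have hq0 : ∀ a b, 0 ≤ q a b := fun a b => by rw [hq']; positivity
  have hν₀0 : ∀ t i, 0 ≤ ν₀ t i := fun t i => by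
    rw [hν₀]
    exact mul_nonneg (mul_nonneg (by norm_num) (le_max_of_le_left (abs_nonneg _)))
      (le_max_of_le_left (hq0 _ _))
  have hν₁0 : ∀ t i, 0 ≤ ν₁ t i := fun t i => by
    rw [hν₁, hξ]
    split_ifs with hc
    · obtain ⟨h1, -, -, -, h2⟩ := hc
      rw [one_mul]
      exact le_max_of_le_left (div_nonneg (mul_nonneg (hν₀0 _ _) h2.le) h1.le)
    · simp
  have hV : ∀ t i, h * ν₀ t i ≤ νhat t i := fun t i => by
    rw [hνhat]
    exact le_max_of_le_right (mul_le_mul_of_nonneg_left (by linarith [hν₁0 t i]) hh0.le)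
  -- lower bounds on the viscosities next to node `i`
  have hVr : ∀ t i, h * (1 / 2 * |u t i| * q (d t (i - 1)) (d t i)) ≤ νhat t i := fun t i => by
    refine le_trans (mul_le_mul_of_nonneg_left ?_ hh0.le) (hV t i)
    rw [hν₀]
    exact mul_le_mul (mul_le_mul_of_nonneg_left (le_max_left _ _) (by norm_num)) (le_max_left _ _)
      (hq0 _ _) (mul_nonneg (by norm_num) (le_max_of_le_left (abs_nonneg _)))
  have hVl : ∀ t i, h * (1 / 2 * |u t i| * q (d t (i - 1)) (d t i)) ≤ νhat t (i - 1) :=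
      fun t i => by
    refine le_trans (mul_le_mul_of_nonneg_left ?_ hh0.le) (hV t (i - 1))
    rw [hν₀, sub_add_cancel]
    exact mul_le_mul (mul_le_mul_of_nonneg_left (le_max_right _ _) (by norm_num)) (le_max_right _ _)
      (hq0 _ _) (mul_nonneg (by norm_num) (le_max_of_le_left (abs_nonneg _)))
  have hle : ∀ t j, |u t j| ≤ ‖u t‖ := fun t j => norm_le_pi_norm (u t) j
  have hpos : ∀ t ∈ Icc (0 : ℝ) T, ∀ i, u t i = ‖u t‖ → u' t i ≤ ε / 2 * ‖u t‖ := by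
    intro t ht i hi
    have ha : 0 ≤ u t i := hi ▸ norm_nonneg _
    have hb : |u t (i + 1)| ≤ u t i := hi ▸ hle t _
    have hc : |u t (i - 1)| ≤ u t i := hi ▸ hle t _
    have e1 : d t i = -((u t i - u t (i + 1)) / h) := by rw [hd]; ring
    have e2 : d t (i - 1) = (u t i - u t (i - 1)) / h := by rw [hd, sub_add_cancel]
    have p1 : 0 ≤ (u t i - u t (i + 1)) / h := div_nonneg (by linarith [(abs_le.1 hb).2]) hh0.le
    have p2 : 0 ≤ (u t i - u t (i - 1)) / h := div_nonneg (by linarith [(abs_le.1 hc).2]) hh0.le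
    have eq : q (d t (i - 1)) (d t i) = ((u t i - u t (i + 1)) / h + (u t i - u t (i - 1)) / h)
        / ((u t i - u t (i + 1)) / h + (u t i - u t (i - 1)) / h + ε) := by
      rw [hq', e1, e2, abs_neg, abs_of_nonneg p1, abs_of_nonneg p2, abs_of_nonpos (by linarith)]
      congr 1 <;> ring
    have k1 := hVr t i
    have k2 := hVl t i
    rw [eq, abs_of_nonneg ha] at k1 k2
    have key := node_bound_s12 h ε _ _ _ _ _ hh0 hε hb hc k1 k2
    have hs := hscheme i t ht
    rw [e1, e2] at hs
    rw [← hi]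
    refine le_of_mul_le_mul_left ?_ hh0
    linarith
  have hneg : ∀ t ∈ Icc (0 : ℝ) T, ∀ i, -u t i = ‖u t‖ → -u' t i ≤ ε / 2 * ‖u t‖ := by
    intro t ht i hi
    have ha : 0 ≤ -u t i := hi ▸ norm_nonneg _
    have hb : |-u t (i - 1)| ≤ -u t i := by rw [abs_neg]; exact hi ▸ hle t _
    have hc : |-u t (i + 1)| ≤ -u t i := by rw [abs_neg]; exact hi ▸ hle t _
    have e1 : d t i = (-u t i - -u t (i + 1)) / h := by rw [hd]; ring
    have e2 : d t (i - 1) = -((-u t i - -u t (i - 1)) / h) := by rw [hd, sub_add_cancel]; ring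
    have p1 : 0 ≤ (-u t i - -u t (i + 1)) / h := div_nonneg (by linarith [(abs_le.1 hc).2]) hh0.le
    have p2 : 0 ≤ (-u t i - -u t (i - 1)) / h := div_nonneg (by linarith [(abs_le.1 hb).2]) hh0.le
    have eq : q (d t (i - 1)) (d t i) =
        ((-u t i - -u t (i - 1)) / h + (-u t i - -u t (i + 1)) / h)
        / ((-u t i - -u t (i - 1)) / h + (-u t i - -u t (i + 1)) / h + ε) := by
      rw [hq', e1, e2, abs_neg, abs_of_nonneg p1, abs_of_nonneg p2, abs_of_nonneg (by linarith)]
      congr 1; ring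
    have k1 := hVr t i
    have k2 := hVl t i
    rw [eq, abs_of_nonpos (by linarith)] at k1 k2
    have key := node_bound_s12 h ε _ _ _ _ _ hh0 hε hb hc k2 k1
    have hs := hscheme i t ht
    rw [e1, e2] at hs
    rw [← hi]
    refine le_of_mul_le_mul_left ?_ hh0
    linarith
  have hcont : ContinuousOn (fun t => ‖u t‖) (Icc 0 T) := by
    refine ContinuousOn.norm ?_
    exact continuousOn_pi.2 fun i t ht => (hderiv i t ht).continuousWithinAt
  have hU : ‖u 0‖ ≤ U₀ := by
    rw [hU₀]
    obtain ⟨y, hy⟩ : ∃ y, y = Finset.univ.sup' ⟨(0 : ZMod N), Finset.mem_univ _⟩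
      fun j => |u 0 j| := ⟨_, rfl⟩
    have hj : ∀ j, |u 0 j| ≤ y := fun j => by
      rw [hy]; exact Finset.le_sup' (fun j => |u 0 j|) (Finset.mem_univ j)
    rw [← hy]
    exact (pi_norm_le_iff_of_nonneg ((abs_nonneg _).trans (hj 0))).2 hj
  have hU0 : 0 ≤ U₀ := (norm_nonneg _).trans hU
  have hgr := le_gronwallBound_of_liminf_deriv_right_le (f := fun t => ‖u t‖)
    (f' := fun t => ε / 2 * ‖u t‖) (δ := U₀) (K := ε / 2) (ε := 0) hcont (by
      intro x hx r hr
      have hx' : x ∈ Icc 0 T := ⟨hx.1, hx.2.le⟩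
      have hr0 : 0 < r := lt_of_le_of_lt (by positivity) hr
      refine Filter.Eventually.frequently ?_
      have E1 : ∀ᶠ z in nhdsWithin x (Ioi x), ∀ i, u z i < ‖u x‖ + r * (z - x) :=
        Filter.eventually_all.2 fun i => eventually_lt_line T x _ r _ _ hx hr0 (hderiv i x hx')
          ((le_abs_self _).trans (hle x i)) fun he => (hpos x hx' i he).trans_lt hr
      have E2 : ∀ᶠ z in nhdsWithin x (Ioi x), ∀ i, -u z i < ‖u x‖ + r * (z - x) :=
        Filter.eventually_all.2 fun i => eventually_lt_line T x _ r _ _ hx hr0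
          (hderiv i x hx').neg
          ((neg_le_abs _).trans (hle x i)) fun he => (hneg x hx' i he).trans_lt hr
      filter_upwards [E1, E2, self_mem_nhdsWithin] with z h1 h2 hz
      have hz0 : 0 < z - x := sub_pos.2 hz
      rw [inv_mul_lt_iff₀ hz0, sub_lt_iff_lt_add']
      have : 0 < ‖u x‖ + r * (z - x) := by positivity
      have hj : ∀ i, |u z i| < ‖u x‖ + r * (z - x) := fun i =>
        abs_lt.2 ⟨by linarith [h2 i], h1 i⟩
      have := (pi_norm_lt_iff (x := u z) this).2 hj
      linarith) hU (by intro x _; simp)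
  intro t ht i
  have h1 := (hle t i).trans (hgr t ht)
  rw [gronwallBound_ε0, sub_zero] at h1
  refine h1.trans ?_
  rw [mul_comm]
  refine mul_le_mul_of_nonneg_right ?_ hU0
  have h2 : ε / 2 * t ≤ ε * T / 2 := by nlinarith [ht.2]
  refine (Real.exp_le_exp.2 h2).trans ?_
  have hp : 0 < ε * T := by positivity
  have h3 : 1 - ε * T / 2 ≤ Real.exp (-(ε * T / 2)) := by
    linarith [Real.add_one_le_exp (-(ε * T / 2))]
  have h4 : Real.exp (ε * T / 2) * Real.exp (-(ε * T / 2)) = 1 := by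
    rw [← Real.exp_add]; simp
  have h5 := Real.exp_pos (ε * T / 2)
  have h6 : Real.exp (ε * T / 2) * (1 - ε * T / 2) ≤ 1 := by
    exact (mul_le_mul_of_nonneg_left h3 h5.le).trans h4.le
  have h7 : 1 ≤ (1 + ε * T) * (1 - ε * T / 2) := by nlinarith
  exact le_of_mul_le_mul_right (h6.trans h7) (by linarith)
end

section
/- There exists a constant C > 0, independent of N, h, ν, T and the data, such that the following holds. Let u₀ : ℝ → ℝ be 1-periodic and continuous, and let u : [0,T] → (ℤ/Nℤ → ℝ) solve the mass-lumped Galerkin scheme with linear artificial viscosity, with initial nodal values given by the L²-projection: u_h(·,0) = π_h u₀. Then ‖u_h(·,T)‖_{L²(0,1)} + ( ∫₀^T h·∑_i ν̂_i·d_i(t)² dt )^{1/2} ≤ C·‖u₀‖_{L²(0,1)} (discrete energy estimate). -/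
open Set

/-- The continuous, 1-periodic, piecewise linear function on the uniform mesh
`xᵢ = i/N`, `i ∈ ZMod N`, with nodal values `v`: on the element
`[xᵢ, xᵢ₊₁]` it equals `vᵢ + (x − xᵢ)·(vᵢ₊₁ − vᵢ)/h`, `h = 1/N`. -/
noncomputable def plin (N : ℕ) (v : ZMod N → ℝ) (x : ℝ) : ℝ :=
  v ((⌊x * (N : ℝ)⌋ : ℤ) : ZMod N)
    + (x * (N : ℝ) - (⌊x * (N : ℝ)⌋ : ℤ)) *
        (v (((⌊x * (N : ℝ)⌋ : ℤ) : ZMod N) + 1) - v ((⌊x * (N : ℝ)⌋ : ℤ) : ZMod N))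

open MeasureTheory in
lemma plin_measurable (N : ℕ) (v : ZMod N → ℝ) : Measurable (plin N v) := by
  have hfl : Measurable (fun x : ℝ => ⌊x * (N : ℝ)⌋) :=
    Int.measurable_floor.comp (measurable_id.mul_const _)
  have h1 : ∀ g : ℤ → ℝ, Measurable (fun x : ℝ => g ⌊x * (N : ℝ)⌋) := fun g =>
    (measurable_from_top (f := g)).comp hfl
  unfold plin
  refine (h1 (fun k => v (k : ZMod N))).add (Measurable.mul ?_ ?_)
  · exact (measurable_id.mul_const _).sub (h1 (fun k => (k : ℝ)))
  · exact (h1 (fun k => v ((k : ZMod N) + 1))).sub (h1 (fun k => v (k : ZMod N)))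

lemma plin_bdd (N : ℕ) [NeZero N] (v : ZMod N → ℝ) : ∃ M : ℝ, ∀ x, |plin N v x| ≤ M := by
  refine ⟨3 * ∑ i, |v i|, fun x => ?_⟩
  have hv : ∀ i, |v i| ≤ ∑ i, |v i| := fun i =>
    Finset.single_le_sum (f := fun i => |v i|) (fun _ _ => abs_nonneg _) (Finset.mem_univ i)
  have h0 := Int.floor_le (x * (N : ℝ))
  have h1 := Int.lt_floor_add_one (x * (N : ℝ))
  unfold plin
  have ha := hv ((⌊x * (N : ℝ)⌋ : ℤ) : ZMod N)
  have hb := hv (((⌊x * (N : ℝ)⌋ : ℤ) : ZMod N) + 1)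
  refine (abs_add_le _ _).trans ?_
  rw [abs_mul]
  have hc : |x * (N : ℝ) - (⌊x * (N : ℝ)⌋ : ℤ)| ≤ 1 := by
    rw [abs_le]; constructor <;> linarith
  have hd := abs_sub (v (((⌊x * (N : ℝ)⌋ : ℤ) : ZMod N) + 1)) (v ((⌊x * (N : ℝ)⌋ : ℤ) : ZMod N))
  have he := mul_le_mul hc le_rfl (abs_nonneg (v (((⌊x * (N : ℝ)⌋ : ℤ) : ZMod N) + 1) -
    v ((⌊x * (N : ℝ)⌋ : ℤ) : ZMod N))) zero_le_one
  linarith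

open MeasureTheory in
lemma bdd_meas_intervalIntegrable (f : ℝ → ℝ) (hf : Measurable f) (a b : ℝ)
    (hM : ∃ M : ℝ, ∀ x ∈ Set.uIcc a b, |f x| ≤ M) : IntervalIntegrable f volume a b := by
  obtain ⟨M, hM⟩ := hM
  rw [intervalIntegrable_iff]
  refine Measure.integrableOn_of_bounded (M := M) (by simp) hf.aestronglyMeasurable ?_
  refine (ae_restrict_iff' measurableSet_uIoc).2 (Filter.Eventually.of_forall fun x hx => ?_)
  exact hM x (uIoc_subset_uIcc hx)

lemma sum_range_zmod (N : ℕ) [NeZero N] (f : ZMod N → ℝ) :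
    ∑ k ∈ Finset.range N, f (k : ZMod N) = ∑ i, f i := by
  refine Finset.sum_nbij' (fun k => (k : ZMod N)) (fun i => i.val) ?_ ?_ ?_ ?_ ?_
  · intros; simp
  · intro i _; simpa using ZMod.val_lt i
  · intro k hk; exact ZMod.val_cast_of_lt (by simpa using hk)
  · intro i _; simp
  · intros; rfl

lemma sum_shift (N : ℕ) [NeZero N] (f : ZMod N → ℝ) : ∑ i, f (i + 1) = ∑ i, f i :=
  Equiv.sum_comp (Equiv.addRight (1 : ZMod N)) f

open MeasureTheory in
lemma plin_sq_integral (N : ℕ) [NeZero N] (v : ZMod N → ℝ) :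
    (∫ x in (0 : ℝ)..1, plin N v x ^ 2)
      = (1 / N : ℝ) / 3 * ∑ i, (v i ^ 2 + v i * v (i + 1) + v (i + 1) ^ 2) := by
  have hN : (0 : ℝ) < N := by exact_mod_cast Nat.pos_of_ne_zero (NeZero.ne N)
  have hint : ∀ a b : ℝ, IntervalIntegrable (fun x => plin N v x ^ 2) volume a b := by
    intro a b
    obtain ⟨M, hM⟩ := plin_bdd N v
    refine bdd_meas_intervalIntegrable _ ((plin_measurable N v).pow_const 2) a b
      ⟨M ^ 2, fun x _ => ?_⟩
    rw [abs_pow]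
    exact pow_le_pow_left₀ (abs_nonneg _) (hM x) 2
  have h1 := intervalIntegral.sum_integral_adjacent_intervals (n := N)
    (a := fun k : ℕ => (k : ℝ) / N) (f := fun x => plin N v x ^ 2) (μ := volume)
    (fun k _ => hint _ _)
  simp only [Nat.cast_zero, zero_div, div_self hN.ne'] at h1
  rw [← h1, ← sum_range_zmod, Finset.mul_sum]
  refine Finset.sum_congr rfl fun k _ => ?_
  have hle : (k : ℝ) / N ≤ ((k + 1 : ℕ) : ℝ) / N := by
    gcongr; simp
  have h2 : (∫ x in ((k : ℝ) / N)..(((k + 1 : ℕ) : ℝ) / N), plin N v x ^ 2)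
      = ∫ x in ((k : ℝ) / N)..(((k + 1 : ℕ) : ℝ) / N),
        (fun y : ℝ => (v (k : ZMod N) + (y - k) * (v ((k : ZMod N) + 1) - v (k : ZMod N))) ^ 2)
          (x * N) := by
    rw [intervalIntegral.integral_of_le hle, intervalIntegral.integral_of_le hle,
      integral_Ioc_eq_integral_Ioo, integral_Ioc_eq_integral_Ioo]
    refine setIntegral_congr_fun measurableSet_Ioo fun x hx => ?_
    have hf : ⌊x * (N : ℝ)⌋ = (k : ℤ) := by
      rw [Int.floor_eq_iff]
      have ha := (div_lt_iff₀ hN).1 hx.1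
      have hb := (lt_div_iff₀ hN).1 hx.2
      push_cast at hb ⊢
      exact ⟨ha.le, hb⟩
    simp only [plin, hf]
    push_cast
    rfl
  rw [h2, intervalIntegral.integral_comp_mul_right (fun y : ℝ => (v (k : ZMod N) +
    (y - k) * (v ((k : ZMod N) + 1) - v (k : ZMod N))) ^ 2) hN.ne', div_mul_cancel₀ _ hN.ne',
    div_mul_cancel₀ _ hN.ne']
  generalize v (k : ZMod N) = a
  generalize v ((k : ZMod N) + 1) = b
  have h3 : (∫ y in (k : ℝ)..((k + 1 : ℕ) : ℝ), (a + (y - k) * (b - a)) ^ 2)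
      = (a ^ 2 + a * b + b ^ 2) / 3 := by
    have := intervalIntegral.integral_eq_sub_of_hasDerivAt
      (f := fun y : ℝ => a ^ 2 * (y - k) + a * (b - a) * (y - k) ^ 2 + (b - a) ^ 2 / 3 * (y - k) ^ 3)
      (f' := fun y : ℝ => (a + (y - k) * (b - a)) ^ 2) (a := (k : ℝ)) (b := ((k + 1 : ℕ) : ℝ))
      (fun y _ => by
        have hy : HasDerivAt (fun y : ℝ => y - k) 1 y := (hasDerivAt_id y).sub_const _
        have := ((hy.const_mul (a ^ 2)).add ((hy.pow 2).const_mul (a * (b - a)))).add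
          ((hy.pow 3).const_mul ((b - a) ^ 2 / 3))
        refine this.congr_deriv ?_
        push_cast
        ring)
      (Continuous.intervalIntegrable (by fun_prop) _ _)
    rw [this]
    push_cast
    ring
  rw [h3, smul_eq_mul]
  ring

/-- **Discrete energy estimate for the mass-lumped Galerkin scheme with linear
artificial viscosity:**  there is a constant `C`, independent of `N`, `h`, `ν`,
`T` and the data, such that if the initial nodal values are the `L²`-projection
of a continuous 1-periodic `u₀`, then
`‖u_h(T)‖_{L²} + (∫₀ᵀ h ∑ᵢ ν̂ dᵢ(t)² dt)^{1/2} ≤ C ‖u₀‖_{L²(0,1)}`. -/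
theorem discrete_energy_estimate :
    ∃ C : ℝ, 0 < C ∧
      ∀ (N : ℕ) [NeZero N], 3 ≤ N →
      ∀ T ν : ℝ, 0 < T → 0 ≤ ν →
      ∀ u₀ : ℝ → ℝ, Continuous u₀ → (∀ x, u₀ (x + 1) = u₀ x) →
      ∀ u u' : ℝ → ZMod N → ℝ, ∀ h : ℝ, h = 1 / N →
      ∀ d : ℝ → ZMod N → ℝ, (∀ t i, d t i = (u t (i + 1) - u t i) / h) →
      ∀ U₀ : ℝ,
        U₀ = (Finset.univ.sup' ⟨(0 : ZMod N), Finset.mem_univ _⟩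
          fun j => |u 0 j|) →
      ∀ νhat : ℝ, νhat = max (U₀ * h / 2) ν →
      -- the scheme
      (∀ i, ∀ t ∈ Icc (0 : ℝ) T,
        HasDerivWithinAt (fun s => u s i) (u' t i) (Icc (0 : ℝ) T) t) →
      (∀ i, ∀ t ∈ Icc (0 : ℝ) T,
        h * u' t i
          = -(1 / 6) * (u t (i + 1) ^ 2 + u t i * u t (i + 1)
              - u t i * u t (i - 1) - u t (i - 1) ^ 2)
            + νhat * d t i - νhat * d t (i - 1)) →
      -- initial data : u_h(·,0) = π_h u₀  (L²-orthogonality of the residual)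
      (∀ v : ZMod N → ℝ,
        (∫ x in (0 : ℝ)..1, (u₀ x - plin N (u 0) x) * plin N v x) = 0) →
      -- discrete energy estimate
      Real.sqrt ((h / 3) * ∑ i : ZMod N,
            (u T i ^ 2 + u T i * u T (i + 1) + u T (i + 1) ^ 2))
          + Real.sqrt (∫ t in (0 : ℝ)..T, h * ∑ i : ZMod N, νhat * d t i ^ 2)
        ≤ C * Real.sqrt (∫ x in (0 : ℝ)..1, u₀ x ^ 2) := by
  refine ⟨4, by norm_num, ?_⟩
  intro N _ hN3 T ν hT hν u₀ hu₀ _ u u' h hh d hd U₀ _ νhat hνhat hder hsch hproj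
  have hNpos : (0 : ℝ) < N := by exact_mod_cast Nat.pos_of_ne_zero (NeZero.ne N)
  have hhpos : 0 < h := by rw [hh]; positivity
  have hνn : 0 ≤ νhat := by rw [hνhat]; exact le_max_of_le_right hν
  -- projection bound
  obtain ⟨M, hM⟩ := plin_bdd N (u 0)
  have hpm := plin_measurable N (u 0)
  have hP : (∫ x in (0 : ℝ)..1, plin N (u 0) x ^ 2) ≤ ∫ x in (0 : ℝ)..1, u₀ x ^ 2 := by
    have i1 : IntervalIntegrable (fun x => plin N (u 0) x ^ 2) MeasureTheory.volume 0 1 := by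
      refine bdd_meas_intervalIntegrable _ (hpm.pow_const 2) _ _ ⟨M ^ 2, fun x _ => ?_⟩
      rw [abs_pow]
      exact pow_le_pow_left₀ (abs_nonneg _) (hM x) 2
    have i2 : IntervalIntegrable (fun x => (u₀ x - plin N (u 0) x) * plin N (u 0) x)
        MeasureTheory.volume 0 1 := by
      obtain ⟨K, hK⟩ := (isCompact_uIcc (a := (0 : ℝ)) (b := 1)).exists_bound_of_continuousOn
        hu₀.continuousOn
      refine bdd_meas_intervalIntegrable _ ((hu₀.measurable.sub hpm).mul hpm) _ _
        ⟨(K + M) * M, fun x hx => ?_⟩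
      have hk : |u₀ x| ≤ K := by simpa using hK x hx
      change |(u₀ x - plin N (u 0) x) * plin N (u 0) x| ≤ _
      rw [abs_mul]
      have := abs_sub (u₀ x) (plin N (u 0) x)
      have hm := hM x
      exact mul_le_mul (by linarith) hm (abs_nonneg _)
        (by linarith [abs_nonneg (u₀ x), abs_nonneg (plin N (u 0) x)])
    have i3 : IntervalIntegrable (fun x => u₀ x ^ 2) MeasureTheory.volume 0 1 :=
      (hu₀.pow 2).intervalIntegrable _ _
    have h4 : (∫ x in (0 : ℝ)..1, (plin N (u 0) x ^ 2
        + 2 * ((u₀ x - plin N (u 0) x) * plin N (u 0) x))) ≤ ∫ x in (0 : ℝ)..1, u₀ x ^ 2 := by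
      refine intervalIntegral.integral_mono_on zero_le_one (i1.add (i2.const_mul 2)) i3
        fun x _ => ?_
      nlinarith [sq_nonneg (u₀ x - plin N (u 0) x)]
    rw [intervalIntegral.integral_add i1 (i2.const_mul 2), intervalIntegral.integral_const_mul,
      hproj] at h4
    linarith
  rw [plin_sq_integral, ← hh] at hP
  set F := ∫ x in (0 : ℝ)..1, u₀ x ^ 2 with hF
  -- comparison of the lumped and the exact norms
  have hup : ∀ w : ZMod N → ℝ, (h / 3) * ∑ i, (w i ^ 2 + w i * w (i + 1) + w (i + 1) ^ 2)
      ≤ h * ∑ i, w i ^ 2 := by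
    intro w
    have hs := sum_shift N (fun i => w i ^ 2)
    have : ∑ i, (w i ^ 2 + w i * w (i + 1) + w (i + 1) ^ 2)
        ≤ ∑ i, (3 / 2 * w i ^ 2 + 3 / 2 * w (i + 1) ^ 2) :=
      Finset.sum_le_sum fun i _ => by nlinarith [sq_nonneg (w i - w (i + 1))]
    rw [Finset.sum_add_distrib (f := fun i => 3 / 2 * w i ^ 2), ← Finset.mul_sum, ← Finset.mul_sum, hs] at this
    nlinarith
  have hlow : ∀ w : ZMod N → ℝ, h * ∑ i, w i ^ 2
      ≤ 3 * ((h / 3) * ∑ i, (w i ^ 2 + w i * w (i + 1) + w (i + 1) ^ 2)) := by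
    intro w
    have hs := sum_shift N (fun i => w i ^ 2)
    have : ∑ i, (1 / 2 * w i ^ 2 + 1 / 2 * w (i + 1) ^ 2)
        ≤ ∑ i, (w i ^ 2 + w i * w (i + 1) + w (i + 1) ^ 2) :=
      Finset.sum_le_sum fun i _ => by nlinarith [sq_nonneg (w i + w (i + 1))]
    rw [Finset.sum_add_distrib, ← Finset.mul_sum, ← Finset.mul_sum, hs] at this
    nlinarith
  -- energy identity
  have hder2 : ∀ t ∈ Icc (0 : ℝ) T, HasDerivWithinAt (fun s => h * ∑ i, u s i ^ 2)
      (-2 * (h * ∑ i, νhat * d t i ^ 2)) (Icc (0 : ℝ) T) t := by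
    intro t ht
    have h5 : HasDerivWithinAt (fun s => h * ∑ i, u s i ^ 2)
        (h * ∑ i, ((2 : ℕ) : ℝ) * u t i ^ (2 - 1) * u' t i) (Icc (0 : ℝ) T) t :=
      (HasDerivWithinAt.fun_sum fun i _ => (hder i t ht).fun_pow 2).const_mul h
    refine h5.congr_deriv ?_
    have h6 : ∀ i, h * (((2 : ℕ) : ℝ) * u t i ^ (2 - 1) * u' t i)
        = (-(1 / 3) * (u t i * u t (i + 1) ^ 2 + u t i ^ 2 * u t (i + 1))
            + 2 * νhat * (u t i * d t i))
          + ((1 / 3) * (u t i ^ 2 * u t (i - 1) + u t i * u t (i - 1) ^ 2)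
            - 2 * νhat * (u t i * d t (i - 1))) := by
      intro i
      have := hsch i t ht
      calc _ = 2 * u t i * (h * u' t i) := by push_cast; ring
        _ = _ := by rw [this]; ring
    rw [Finset.mul_sum, Finset.sum_congr rfl fun i _ => h6 i, Finset.sum_add_distrib,
      ← sum_shift N (fun i => (1 / 3) * (u t i ^ 2 * u t (i - 1) + u t i * u t (i - 1) ^ 2)
            - 2 * νhat * (u t i * d t (i - 1))), ← Finset.sum_add_distrib, Finset.mul_sum,
      Finset.mul_sum]
    refine Finset.sum_congr rfl fun i _ => ?_
    rw [add_sub_cancel_right]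
    have h7 : u t (i + 1) = u t i + h * d t i := by
      rw [hd]; field_simp; ring
    rw [h7]
    ring
  have hucont : ∀ i, ContinuousOn (fun s => u s i) (Icc (0 : ℝ) T) := fun i t ht =>
    (hder i t ht).continuousWithinAt
  have hDcont : ContinuousOn (fun t => h * ∑ i, νhat * d t i ^ 2) (Icc (0 : ℝ) T) := by
    simp only [hd]
    refine continuousOn_const.mul (continuousOn_finsetSum _ fun i _ => ?_)
    exact continuousOn_const.mul ((((hucont (i + 1)).sub (hucont i)).div_const h).pow 2)
  have hFTC := intervalIntegral.integral_eq_sub_of_hasDerivAt_of_le hT.le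
    (f := fun s => h * ∑ i, u s i ^ 2) (f' := fun t => -2 * (h * ∑ i, νhat * d t i ^ 2))
    (fun t ht => (hder2 t ht).continuousWithinAt)
    (fun t ht => (hder2 t (Ioo_subset_Icc_self ht)).hasDerivAt (Icc_mem_nhds ht.1 ht.2))
    (ContinuousOn.intervalIntegrable (by
      rw [uIcc_of_le hT.le]; exact continuousOn_const.mul hDcont))
  rw [intervalIntegral.integral_const_mul] at hFTC
  have hB : 0 ≤ ∫ t in (0 : ℝ)..T, h * ∑ i : ZMod N, νhat * d t i ^ 2 :=
    intervalIntegral.integral_nonneg hT.le fun t _ =>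
      mul_nonneg hhpos.le (Finset.sum_nonneg fun i _ => mul_nonneg hνn (sq_nonneg _))
  set B := ∫ t in (0 : ℝ)..T, h * ∑ i : ZMod N, νhat * d t i ^ 2 with hBdef
  have hET : 0 ≤ h * ∑ i, u T i ^ 2 :=
    mul_nonneg hhpos.le (Finset.sum_nonneg fun i _ => sq_nonneg _)
  have ha := hup (u T)
  have hb := hlow (u 0)
  have key : ∀ x : ℝ, x ≤ 4 * F → Real.sqrt x ≤ 2 * Real.sqrt F := by
    intro x hx
    have : Real.sqrt (4 * F) = 2 * Real.sqrt F := by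
      rw [Real.sqrt_mul (by norm_num), show (4 : ℝ) = 2 ^ 2 by norm_num,
        Real.sqrt_sq (by norm_num)]
    rw [← this]
    exact Real.sqrt_le_sqrt hx
  have hF0 : 0 ≤ F := intervalIntegral.integral_nonneg zero_le_one fun x _ => sq_nonneg _
  have k1 := key _ (show (h / 3) * ∑ i : ZMod N,
            (u T i ^ 2 + u T i * u T (i + 1) + u T (i + 1) ^ 2) ≤ 4 * F by linarith)
  have k2 := key B (by linarith)
  linarith
end
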